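/- arXiv:2409.14670 — 12 statements merged into one kernel-verified Lean document; each statement's English description precedes it below -/
import Mathlib

section
/- Energy decay and summed stability for the BDF-1 accelerated gradient flow: Let U be a real Hilbert space and M : U×U→ℝ a symmetric positive semidefinite bilinear form. Fix s>0 and α>0, let u⁰∈U, set d_t u⁰ := 0, and suppose that for every n≥1 there is a linear subspace V_n ⊆ U and an element d_t u^n ∈ V_n such that ⟨d_t²u^n, w⟩_U + (α/(ns))⟨d_t u^n, w⟩_U + M(u^{n-1} + s·d_t u^n, w) = 0 for all w ∈ V_n, where u^n := u^{n-1} + s·d_t u^n and d_t²u^n := (d_t u^n − d_t u^{n-1})/s. Then: (a) for every n≥1, M(u^n,u^n) + ‖d_t u^n‖²_U ≤ M(u^{n-1},u^{n-1}) + ‖d_t u^{n-1}‖²_U; and (b) for every N≥1, M(u^N,u^N) + ‖d_t u^N‖²_U + s²·∑_{n=1}^{N} ( ‖d_t²u^n‖²_U + M(d_t u^n, d_t u^n) + (α/(n s²))‖d_t u^n‖²_U ) ≤ M(u⁰,u⁰). -/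
open scoped RealInnerProductSpace

/-- Energy identity for one implicit step, where `p`, `a` are the old position and velocity,
`b` is the new velocity and `c` is `α` divided by the step index. -/
theorem implicit_step_energy_identity
    {U : Type*} [NormedAddCommGroup U] [InnerProductSpace ℝ U]
    (M : U →ₗ[ℝ] U →ₗ[ℝ] ℝ) (hMsymm : ∀ u v : U, M u v = M v u)
    {s c : ℝ} (hs : s ≠ 0) {p a b : U}
    (h : ⟪s⁻¹ • (b - a), b⟫ + c / s * ⟪b, b⟫ + M (p + s • b) b = 0) :
    M (p + s • b) (p + s • b) + ‖b‖ ^ 2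
        + s ^ 2 * (‖s⁻¹ • (b - a)‖ ^ 2 + M b b + 2 * (c / s ^ 2 * ‖b‖ ^ 2))
      = M p p + ‖a‖ ^ 2 := by
  have hnorm : ‖s⁻¹ • (b - a)‖ ^ 2 = (s⁻¹) ^ 2 * (‖b‖ ^ 2 - 2 * ⟪b, a⟫ + ‖a‖ ^ 2) := by
    rw [norm_smul, mul_pow, norm_sub_sq_real, Real.norm_eq_abs, sq_abs]
  rw [real_inner_smul_left, inner_sub_left, real_inner_self_eq_norm_sq,
    real_inner_comm b a] at h
  simp only [map_add, map_smul, LinearMap.add_apply, LinearMap.smul_apply, smul_eq_mul] at h ⊢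
  rw [hnorm, hMsymm b p]
  field_simp at h ⊢
  linear_combination 2 * h

/-- Energy decay and summed stability for the BDF-1 accelerated gradient flow. -/
theorem bdf1_accelerated_flow_energy_stability
    {U : Type*} [NormedAddCommGroup U] [InnerProductSpace ℝ U]
    (M : U →ₗ[ℝ] U →ₗ[ℝ] ℝ)
    (hMsymm : ∀ u v : U, M u v = M v u)
    (hMpos : ∀ u : U, 0 ≤ M u u)
    (s α : ℝ) (hs : 0 < s) (hα : 0 < α)
    (u dtu : ℕ → U)
    (hdtu0 : dtu 0 = 0)
    (V : ℕ → Submodule ℝ U)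
    (hmem : ∀ n, 1 ≤ n → dtu n ∈ V n)
    (hupdate : ∀ n, 1 ≤ n → u n = u (n - 1) + s • dtu n)
    (hflow : ∀ n, 1 ≤ n → ∀ w ∈ V n,
      ⟪s⁻¹ • (dtu n - dtu (n - 1)), w⟫ + (α / ((n : ℝ) * s)) * ⟪dtu n, w⟫
        + M (u (n - 1) + s • dtu n) w = 0) :
    (∀ n, 1 ≤ n →
      M (u n) (u n) + ‖dtu n‖ ^ 2 ≤ M (u (n - 1)) (u (n - 1)) + ‖dtu (n - 1)‖ ^ 2)
    ∧
    (∀ N, 1 ≤ N →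
      M (u N) (u N) + ‖dtu N‖ ^ 2
        + s ^ 2 * ∑ n ∈ Finset.Icc 1 N,
            (‖s⁻¹ • (dtu n - dtu (n - 1))‖ ^ 2 + M (dtu n) (dtu n)
              + (α / ((n : ℝ) * s ^ 2)) * ‖dtu n‖ ^ 2)
        ≤ M (u 0) (u 0)) := by
  have hstep : ∀ n, 1 ≤ n →
      M (u n) (u n) + ‖dtu n‖ ^ 2
        + s ^ 2 * (‖s⁻¹ • (dtu n - dtu (n - 1))‖ ^ 2 + M (dtu n) (dtu n)
          + (α / ((n : ℝ) * s ^ 2)) * ‖dtu n‖ ^ 2)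
        ≤ M (u (n - 1)) (u (n - 1)) + ‖dtu (n - 1)‖ ^ 2 := by
    intro n hn
    have h := hflow n hn (dtu n) (hmem n hn)
    rw [← div_div] at h
    have hid := implicit_step_energy_identity M hMsymm hs.ne' h
    rw [← hupdate n hn] at hid
    rw [← hid, ← div_div]
    have hdamp : 0 ≤ α / (n : ℝ) / s ^ 2 * ‖dtu n‖ ^ 2 := by positivity
    gcongr _ + s ^ 2 * (_ + ?_)
    linarith
  refine ⟨fun n hn => ?_, fun N hN => ?_⟩
  · have hpos := hMpos (dtu n)
    exact (le_add_of_nonneg_right (by positivity)).trans (hstep n hn)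
  · clear hN
    induction N with
    | zero => simp [hdtu0]
    | succ k ih =>
      have h := hstep (k + 1) (Nat.le_add_left 1 k)
      rw [Finset.sum_Icc_succ_top (Nat.le_add_left 1 k), mul_add]
      simp only [Nat.add_sub_cancel] at h ⊢
      linarith
end

section
/- Unconditional constraint violation for the BDF-1 accelerated gradient flow: Let U be a real Hilbert space, M : U×U→ℝ a symmetric positive semidefinite bilinear form, Z a real normed vector space, B : U×U→Z a symmetric bilinear map with ‖B(u,u)‖_Z ≤ c_Z‖u‖²_U for all u∈U, and u_c∈Z. Fix s>0 and α>0, let u⁰∈U satisfy B(u⁰,u⁰) = u_c, set d_t u⁰ := 0, and suppose that for every n≥1 there is a linear subspace V_n ⊆ U and d_t u^n ∈ V_n such that B(u^{n-1}, d_t u^n) = 0 and ⟨d_t²u^n, w⟩_U + (α/(ns))⟨d_t u^n, w⟩_U + M(u^{n-1} + s·d_t u^n, w) = 0 for all w ∈ V_n, where u^n := u^{n-1} + s·d_t u^n and d_t²u^n := (d_t u^n − d_t u^{n-1})/s. Then for every N≥1, ‖B(u^N,u^N) − u_c‖_Z ≤ c_Z · M(u⁰,u⁰) · N · s². -/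
open scoped RealInnerProductSpace

/-- One implicit step of a damped second-order flow does not increase the energy
`‖d‖ ^ 2 + M v v`. -/
theorem damped_flow_step_energy_le
    {U : Type*} [NormedAddCommGroup U] [InnerProductSpace ℝ U]
    (M : U →ₗ[ℝ] U →ₗ[ℝ] ℝ) (hMsymm : ∀ u v : U, M u v = M v u)
    (hMpos : ∀ u : U, 0 ≤ M u u) {s γ : ℝ} (hs : 0 < s) (hγ : 0 ≤ γ) (v d d' : U)
    (hflow : ⟪s⁻¹ • (d - d'), d⟫ + γ * ⟪d, d⟫ + M (v + s • d) d = 0) :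
    ‖d‖ ^ 2 + M (v + s • d) (v + s • d) ≤ ‖d'‖ ^ 2 + M v v := by
  have hsq := norm_sub_sq_real d' d
  have hMd := hMpos d
  have hsymm := hMsymm d v
  simp only [map_add, map_smul, LinearMap.add_apply, LinearMap.smul_apply, smul_eq_mul,
    inner_sub_left, real_inner_smul_left, real_inner_self_eq_norm_sq] at hflow ⊢
  have htest : ‖d‖ ^ 2 - ⟪d', d⟫ + s * γ * ‖d‖ ^ 2 + s * (M v d + s * M d d) = 0 := by
    have h := congrArg (s * ·) hflow
    field_simp at h
    linear_combination h
  have hdamp : 0 ≤ s * γ * ‖d‖ ^ 2 := by positivity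
  have hdiss : 0 ≤ s ^ 2 * M d d := by positivity
  rw [hsymm]
  nlinarith [sq_nonneg ‖d' - d‖]

/-- A step along a direction in the kernel of the linearized constraint changes the
quadratic constraint only by its second-order term. -/
theorem bilin_self_add_smul_of_apply_eq_zero
    {U : Type*} [AddCommGroup U] [Module ℝ U] {Z : Type*} [AddCommGroup Z] [Module ℝ Z]
    (B : U →ₗ[ℝ] U →ₗ[ℝ] Z) (hBsymm : ∀ u v : U, B u v = B v u) (s : ℝ) {v d : U}
    (h : B v d = 0) : B (v + s • d) (v + s • d) = B v v + s ^ 2 • B d d := by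
  have h' : B d v = 0 := (hBsymm d v).trans h
  simp [h, h', smul_smul, sq]

/-- Unconditional constraint violation for the BDF-1 accelerated gradient flow. -/
theorem bdf1_accelerated_flow_constraint_violation
    {U : Type*} [NormedAddCommGroup U] [InnerProductSpace ℝ U]
    {Z : Type*} [NormedAddCommGroup Z] [NormedSpace ℝ Z]
    (M : U →ₗ[ℝ] U →ₗ[ℝ] ℝ)
    (hMsymm : ∀ u v : U, M u v = M v u)
    (hMpos : ∀ u : U, 0 ≤ M u u)
    (B : U →ₗ[ℝ] U →ₗ[ℝ] Z)
    (hBsymm : ∀ u v : U, B u v = B v u)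
    (cZ : ℝ) (hB : ∀ u : U, ‖B u u‖ ≤ cZ * ‖u‖ ^ 2)
    (u_c : Z)
    (s α : ℝ) (hs : 0 < s) (hα : 0 < α)
    (u dtu : ℕ → U)
    (hdtu0 : dtu 0 = 0)
    (hu0 : B (u 0) (u 0) = u_c)
    (V : ℕ → Submodule ℝ U)
    (hmem : ∀ n, 1 ≤ n → dtu n ∈ V n)
    (hcons : ∀ n, 1 ≤ n → B (u (n - 1)) (dtu n) = 0)
    (hupdate : ∀ n, 1 ≤ n → u n = u (n - 1) + s • dtu n)
    (hflow : ∀ n, 1 ≤ n → ∀ w ∈ V n,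
      ⟪s⁻¹ • (dtu n - dtu (n - 1)), w⟫ + (α / ((n : ℝ) * s)) * ⟪dtu n, w⟫
        + M (u (n - 1) + s • dtu n) w = 0) :
    ∀ N, 1 ≤ N → ‖B (u N) (u N) - u_c‖ ≤ cZ * M (u 0) (u 0) * N * s ^ 2 := by
  have henergy : ∀ n, ‖dtu n‖ ^ 2 + M (u n) (u n) ≤ M (u 0) (u 0) := by
    intro n
    induction n with
    | zero => simp [hdtu0]
    | succ n ih =>
      refine le_trans ?_ ih
      rw [hupdate (n + 1) n.succ_pos]
      exact damped_flow_step_energy_le M hMsymm hMpos hs (by positivity) _ _ _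
        (hflow (n + 1) n.succ_pos _ (hmem (n + 1) n.succ_pos))
  have hsecond : ∀ n, ‖B (dtu n) (dtu n)‖ ≤ cZ * M (u 0) (u 0) := by
    intro n
    have hd : ‖dtu n‖ ^ 2 ≤ M (u 0) (u 0) := by linarith [henergy n, hMpos (u n)]
    rcases le_or_gt 0 cZ with hc | hc
    · exact (hB _).trans (mul_le_mul_of_nonneg_left hd hc)
    · have hU : ∀ v : U, v = 0 := fun v => by
        by_contra hv
        have hv' : 0 < ‖v‖ ^ 2 := by positivity
        linarith [hB v, norm_nonneg (B v v), mul_neg_of_neg_of_pos hc hv']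
      simp [hU (dtu n), hU (u 0)]
  intro N hN
  clear hN
  induction N with
  | zero => simp [hu0]
  | succ n ih =>
    rw [hupdate (n + 1) n.succ_pos,
      bilin_self_add_smul_of_apply_eq_zero B hBsymm s (hcons (n + 1) n.succ_pos),
      Nat.add_sub_cancel, add_sub_right_comm]
    calc ‖B (u n) (u n) - u_c + s ^ 2 • B (dtu (n + 1)) (dtu (n + 1))‖
        ≤ ‖B (u n) (u n) - u_c‖ + s ^ 2 * ‖B (dtu (n + 1)) (dtu (n + 1))‖ := by
          refine (norm_add_le _ _).trans_eq ?_
          rw [norm_smul, Real.norm_of_nonneg (sq_nonneg s)]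
      _ ≤ cZ * M (u 0) (u 0) * n * s ^ 2 + s ^ 2 * (cZ * M (u 0) (u 0)) := by
          gcongr
          · exact hsecond (n + 1)
      _ = cZ * M (u 0) (u 0) * (n + 1 : ℕ) * s ^ 2 := by push_cast; ring
end

section
/- Sharper a priori estimate for the BDF difference equation: Fix an integer k ∈ {2,3,4}. There exists a constant C>0 depending only on k such that for all real sequences (a_n)_{n≥1} and (f_n)_{n≥k} satisfying ∑_{j=0}^{k-1} t̃δ_j a_{n-j} = f_n for all n≥k, and for every N≥k, one has ∑_{n=k}^{N} a_n² ≤ C·( ∑_{n=1}^{k-1} a_n² + ∑_{n=k}^{N} f_n² ). -/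
/-- The BDF-`k` coefficients `δ_i`: `δ_0 = ∑_{r=1}^k 1/r` and
`δ_i = ((-1)^i / i) * binom(k, i)` for `i ≥ 1`. -/
noncomputable def bdfDelta (k i : ℕ) : ℝ :=
  if i = 0 then ∑ r ∈ Finset.Icc 1 k, (1 : ℝ) / r
  else (-1 : ℝ) ^ i / i * (k.choose i)

/-- The summed BDF coefficients `t̃δ_j = ∑_{ℓ=0}^{j} δ_ℓ` (so `t̃δ_0 = δ_0`). -/
noncomputable def bdfTildeDelta (k j : ℕ) : ℝ :=
  ∑ ℓ ∈ Finset.range (j + 1), bdfDelta k ℓ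

/-- Summing a discrete energy-dissipation inequality `x n + V (n + 1) ≤ K * y n + V n`. -/
theorem sum_add_le_of_energy_step {K : ℝ} {x y V : ℕ → ℝ} {k : ℕ}
    (step : ∀ n, k ≤ n → x n + V (n + 1) ≤ K * y n + V n) {N : ℕ} (hN : k ≤ N) :
    ∑ n ∈ Finset.Icc k N, x n + V (N + 1) ≤ K * ∑ n ∈ Finset.Icc k N, y n + V k := by
  induction N, hN using Nat.le_induction with
  | base => simpa using step k le_rfl
  | succ N hN ih =>
    rw [Finset.sum_Icc_succ_top (by omega), Finset.sum_Icc_succ_top (by omega)]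
    linarith [step (N + 1) (by omega)]

/-- A nonnegative discrete energy controlled by the initial values gives the a priori estimate. -/
theorem sum_le_mul_of_energy_step {K s : ℝ} {x y V : ℕ → ℝ} {k : ℕ}
    (hV : ∀ n, 0 ≤ V n) (hVk : V k ≤ K * s)
    (step : ∀ n, k ≤ n → x n + V (n + 1) ≤ K * y n + V n) {N : ℕ} (hN : k ≤ N) :
    ∑ n ∈ Finset.Icc k N, x n ≤ K * (s + ∑ n ∈ Finset.Icc k N, y n) := by
  linarith [sum_add_le_of_energy_step step hN, hV (N + 1)]

/-- Sharper a priori estimate for the BDF difference equation, for `k ∈ {2,3,4}`. -/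
theorem bdf_difference_equation_sharper_estimate
    (k : ℕ) (hk : k = 2 ∨ k = 3 ∨ k = 4) :
    ∃ C : ℝ, 0 < C ∧
      ∀ (a f : ℕ → ℝ),
        (∀ n, k ≤ n → ∑ j ∈ Finset.range k, bdfTildeDelta k j * a (n - j) = f n) →
        ∀ N, k ≤ N →
          ∑ n ∈ Finset.Icc k N, a n ^ 2
            ≤ C * (∑ n ∈ Finset.Icc 1 (k - 1), a n ^ 2
                    + ∑ n ∈ Finset.Icc k N, f n ^ 2) := by
  refine ⟨20, by norm_num, fun a f h N hN => ?_⟩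
  rcases hk with rfl | rfl | rfl
  · refine sum_le_mul_of_energy_step (V := fun n => a (n - 1) ^ 2)
      (fun n => by positivity) ?_ (fun n hn => ?_) hN
    · norm_num
      nlinarith [sq_nonneg (a 1)]
    · obtain ⟨m, rfl⟩ := Nat.exists_eq_add_of_le' hn
      have e := h _ hn
      norm_num [Finset.sum_range_succ, Finset.sum_Icc_succ_top, bdfTildeDelta, bdfDelta,
        Nat.choose] at e ⊢
      rw [← e]
      nlinarith [sq_nonneg (a (m + 2) - a (m + 1)), sq_nonneg (a (m + 1)),
        sq_nonneg (a (m + 2)), sq_nonneg (2 * a (m + 2) - a (m + 1))]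
  · refine sum_le_mul_of_energy_step
      (V := fun n => 4 * a (n - 1) ^ 2 + a (n - 2) ^ 2 + (a (n - 1) - a (n - 2)) ^ 2 / 2)
      (fun n => by positivity) ?_ (fun n hn => ?_) hN
    · norm_num [Finset.sum_Icc_succ_top]
      nlinarith [sq_nonneg (a 1), sq_nonneg (a 2), sq_nonneg (a 1 + a 2)]
    · obtain ⟨m, rfl⟩ := Nat.exists_eq_add_of_le' hn
      have e := h _ hn
      norm_num [Finset.sum_range_succ, Finset.sum_Icc_succ_top, bdfTildeDelta, bdfDelta,
        Nat.choose] at e ⊢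
      simp only [show m + 3 - 2 = m + 1 from rfl,
        show m + 3 + 1 - 2 = m + 2 from rfl] at e ⊢
      rw [← e]
      linarith [sq_nonneg (a (m + 1) - 44 / 37 * a (m + 2) + 55 / 37 * a (m + 3)),
        sq_nonneg (a (m + 2) - 971 / 1021 * a (m + 3)), sq_nonneg (a (m + 3)),
        sq_nonneg (11 / 6 * a (m + 3) - 7 / 6 * a (m + 2) + 1 / 3 * a (m + 1))]
  · refine sum_le_mul_of_energy_step
      (V := fun n => 5 * a (n - 1) ^ 2 + 2 * a (n - 2) ^ 2 + a (n - 3) ^ 2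
        + 3 * (a (n - 1) - a (n - 2)) ^ 2 + (a (n - 1) + a (n - 3)) ^ 2)
      (fun n => by positivity) ?_ (fun n hn => ?_) hN
    · norm_num [Finset.sum_Icc_succ_top]
      nlinarith [sq_nonneg (a 1), sq_nonneg (a 2), sq_nonneg (a 3), sq_nonneg (a 3 + a 2),
        sq_nonneg (a 3 - a 1)]
    · obtain ⟨m, rfl⟩ := Nat.exists_eq_add_of_le' hn
      have e := h _ hn
      norm_num [Finset.sum_range_succ, Finset.sum_Icc_succ_top, bdfTildeDelta, bdfDelta,
        Nat.choose] at e ⊢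
      simp only [show m + 4 - 2 = m + 2 from rfl,
        show m + 4 - 3 = m + 1 from rfl,
        show m + 4 + 1 - 2 = m + 3 from rfl,
        show m + 4 + 1 - 3 = m + 2 from rfl] at e ⊢
      rw [← e]
      linarith [sq_nonneg (a (m + 1) - 5 / 3 * a (m + 2) + 127 / 39 * a (m + 3)
          - 125 / 39 * a (m + 4)),
        sq_nonneg (a (m + 2) - 242 / 157 * a (m + 3) + 241 / 157 * a (m + 4)),
        sq_nonneg (a (m + 3) - 1699 / 1594 * a (m + 4)), sq_nonneg (a (m + 4))]
end

section
/- Key algebraic identity for BDF-k schemes (existence and uniqueness of the coefficients β): For every integer k≥1 there exist unique real numbers β_{jℓ}, indexed by 1≤j≤k and 0≤ℓ≤k−j, such that for every sequence (a_n) of real numbers and every n≥k: ∑_{j=0}^{k} δ_j·a_{n-j}² − 2·(∑_{j=0}^{k} δ_j a_{n-j})·(∑_{j=0}^{k-1} γ_j a_{n-j-1}) = ∑_{j=1}^{k} ∑_{ℓ=0}^{k-j} β_{jℓ}·( ∑_{m=0}^{j} (−1)^m binom(j,m) a_{n-ℓ-m} )². -/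
/-- The BDF-`k` extrapolation coefficients `γ_j = (-1)^j * binom(k, j+1)`. -/
noncomputable def bdfGamma (k j : ℕ) : ℝ := (-1 : ℝ) ^ j * (k.choose (j + 1))

/-- The coefficient of `x p` in the `j`-th backward difference
`∑_{m=0}^{j} (-1)^m binom(j,m) x (l+m)`. -/
noncomputable def diffCoeff (j l p : ℕ) : ℝ :=
  if l ≤ p then (-1 : ℝ) ^ (p - l) * (j.choose (p - l)) else 0

/-- The `(p, q)` entry of the symmetric matrix of `∑ β_{jl} (d^j x_l)²`. -/
noncomputable def diffMatrix (k : ℕ) (β : ℕ → ℕ → ℝ) (p q : ℕ) : ℝ :=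
  ∑ j ∈ Finset.Icc 1 k, ∑ l ∈ Finset.range (k - j + 1),
    β j l * (diffCoeff j l p * diffCoeff j l q)

/-- The coefficient of `x q` in the extrapolation `∑ γ_j x (j+1)`. -/
noncomputable def extrapCoeff (k q : ℕ) : ℝ := if q = 0 then 0 else bdfGamma k (q - 1)

/-- The symmetric matrix of the left-hand side of the key identity. -/
noncomputable def bdfMatrix (k p q : ℕ) : ℝ :=
  (if p = q then bdfDelta k p else 0)
    - (bdfDelta k p * extrapCoeff k q + bdfDelta k q * extrapCoeff k p)

lemma sum_diffCoeff_mul {k j l : ℕ} (h : l + j ≤ k) (x : ℕ → ℝ) :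
    ∑ p ∈ Finset.range (k + 1), diffCoeff j l p * x p
      = ∑ m ∈ Finset.range (j + 1), (-1 : ℝ) ^ m * (j.choose m) * x (l + m) := by
  obtain ⟨d, rfl⟩ := Nat.exists_eq_add_of_le h
  rw [show l + j + d + 1 = l + (j + 1 + d) by ring, Finset.sum_range_add, Finset.sum_range_add]
  have h1 : ∑ p ∈ Finset.range l, diffCoeff j l p * x p = 0 := by
    refine Finset.sum_eq_zero fun p hp => ?_
    rw [diffCoeff, if_neg (by simpa using hp), zero_mul]
  have h2 : ∑ m ∈ Finset.range d,
      diffCoeff j l (l + (j + 1 + m)) * x (l + (j + 1 + m)) = 0 := by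
    refine Finset.sum_eq_zero fun m _ => ?_
    rw [diffCoeff, if_pos (by omega), Nat.choose_eq_zero_of_lt (by omega)]
    simp
  rw [h1, h2, zero_add, add_zero]
  refine Finset.sum_congr rfl fun m _ => ?_
  simp [diffCoeff]

lemma sum_alternating_choose {j : ℕ} (hj : 1 ≤ j) :
    ∑ m ∈ Finset.range (j + 1), (-1 : ℝ) ^ m * (j.choose m) = 0 := by
  have h := Int.alternating_sum_range_choose_of_ne (n := j) (by omega)
  exact_mod_cast h

lemma sum_diffCoeff {k j l : ℕ} (hj : 1 ≤ j) (h : l + j ≤ k) :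
    ∑ p ∈ Finset.range (k + 1), diffCoeff j l p = 0 := by
  have := sum_diffCoeff_mul h (fun _ => 1)
  simpa [sum_alternating_choose hj] using this

lemma diffCoeff_mul_of_le {i j l p : ℕ} (h : j ≤ i) :
    diffCoeff j l p * diffCoeff j l (p + i)
      = if j = i ∧ l = p then (-1 : ℝ) ^ i else 0 := by
  unfold diffCoeff
  by_cases hl : l ≤ p
  · rw [if_pos hl, if_pos (by omega)]
    by_cases hc : j = i ∧ l = p
    · obtain ⟨rfl, rfl⟩ := hc
      simp
    · rw [if_neg hc, Nat.choose_eq_zero_of_lt (show j < p + i - l by omega)]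
      simp
  · rw [if_neg hl, if_neg (show ¬(j = i ∧ l = p) by omega), zero_mul]

lemma diffMatrix_symm (k : ℕ) (β : ℕ → ℕ → ℝ) (p q : ℕ) :
    diffMatrix k β p q = diffMatrix k β q p := by
  unfold diffMatrix
  simp only [mul_comm (diffCoeff _ _ p)]

lemma diffMatrix_add (k : ℕ) (β β' : ℕ → ℕ → ℝ) (p q : ℕ) :
    diffMatrix k (β + β') p q = diffMatrix k β p q + diffMatrix k β' p q := by
  simp [diffMatrix, add_mul, Finset.sum_add_distrib]

lemma diffMatrix_sub (k : ℕ) (β β' : ℕ → ℕ → ℝ) (p q : ℕ) :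
    diffMatrix k (β - β') p q = diffMatrix k β p q - diffMatrix k β' p q := by
  simp [diffMatrix, sub_mul, Finset.sum_sub_distrib]

lemma sum_diffMatrix (k : ℕ) (β : ℕ → ℕ → ℝ) (p : ℕ) :
    ∑ q ∈ Finset.range (k + 1), diffMatrix k β p q = 0 := by
  unfold diffMatrix
  rw [Finset.sum_comm]
  refine Finset.sum_eq_zero fun j hj => ?_
  rw [Finset.sum_comm]
  refine Finset.sum_eq_zero fun l hl => ?_
  rw [Finset.mem_Icc] at hj
  rw [Finset.mem_range] at hl
  rw [← Finset.mul_sum, ← Finset.mul_sum, sum_diffCoeff hj.1 (by omega), mul_zero, mul_zero]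

/-- Triangularity: if `β j` vanishes for `j > i`, the `i`-th superdiagonal reads off `β i`. -/
lemma diffMatrix_superdiag {k i p : ℕ} {β : ℕ → ℕ → ℝ} (hi : 1 ≤ i) (hip : i + p ≤ k)
    (hβ : ∀ j l, i < j → β j l = 0) :
    diffMatrix k β p (p + i) = (-1 : ℝ) ^ i * β i p := by
  unfold diffMatrix
  rw [Finset.sum_eq_single i]
  · rw [Finset.sum_eq_single p]
    · rw [diffCoeff_mul_of_le le_rfl, if_pos ⟨rfl, rfl⟩, mul_comm]
    · intro l _ hl
      rw [diffCoeff_mul_of_le le_rfl, if_neg (by tauto), mul_zero]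
    · intro h
      exact absurd (Finset.mem_range.2 (by omega)) h
  · intro j _ hj
    refine Finset.sum_eq_zero fun l _ => ?_
    rcases lt_or_gt_of_ne hj with h | h
    · rw [diffCoeff_mul_of_le h.le, if_neg (by tauto), mul_zero]
    · rw [hβ j l h, zero_mul]
  · intro h
    exact absurd (Finset.mem_Icc.2 (by omega)) h

lemma eq_zero_of_diffMatrix_eq_zero {k : ℕ} {β : ℕ → ℕ → ℝ}
    (hβ : ∀ j l : ℕ, ¬(1 ≤ j ∧ j ≤ k ∧ l ≤ k - j) → β j l = 0)
    (h : ∀ i p, 1 ≤ i → i + p ≤ k → diffMatrix k β p (p + i) = 0) : β = 0 := by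
  have key : ∀ t j l, k < j + t → β j l = 0 := by
    intro t
    induction t with
    | zero => exact fun j l hj => hβ j l (by omega)
    | succ t ih =>
      intro j l hj
      by_cases hs : 1 ≤ j ∧ j ≤ k ∧ l ≤ k - j
      · have := diffMatrix_superdiag (k := k) (i := j) (p := l) (β := β) hs.1 (by omega)
          (fun j' l' hj' => ih j' l' (by omega))
        rw [h j l hs.1 (by omega)] at this
        simpa using this.symm
      · exact hβ j l hs
  ext j l
  exact key (k + 1) j l (by omega)

lemma exists_diffMatrix_superdiag (k : ℕ) (M : ℕ → ℕ → ℝ) :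
    ∃ β : ℕ → ℕ → ℝ, (∀ j l : ℕ, ¬(1 ≤ j ∧ j ≤ k ∧ l ≤ k - j) → β j l = 0) ∧
      ∀ i p, 1 ≤ i → i + p ≤ k → diffMatrix k β p (p + i) = M p (p + i) := by
  have key : ∀ t, ∃ β : ℕ → ℕ → ℝ,
      (∀ j l : ℕ, ¬(1 ≤ j ∧ j ≤ k ∧ l ≤ k - j) → β j l = 0) ∧
      ∀ i p, 1 ≤ i → i + p ≤ k → k < i + t → diffMatrix k β p (p + i) = M p (p + i) := by
    intro t
    induction t with
    | zero => exact ⟨0, fun _ _ _ => rfl, fun i p _ _ _ => by omega⟩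
    | succ t ih =>
      obtain ⟨β, hβ, hM⟩ := ih
      let F : ℕ → ℕ → ℝ := fun j l =>
        if (1 ≤ j ∧ j ≤ k ∧ l ≤ k - j) ∧ j + t = k then
          (-1 : ℝ) ^ j * (M l (l + j) - diffMatrix k β l (l + j)) else 0
      refine ⟨β + F, fun j l h => ?_, fun i p hi hip hit => ?_⟩
      · simp only [Pi.add_apply, hβ j l h, F]
        rw [if_neg (by tauto), add_zero]
      · rw [diffMatrix_add, diffMatrix_superdiag (β := F) hi hip
          (fun j l hj => if_neg (by omega))]
        by_cases hk : i + t = k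
        · simp only [F]
          rw [if_pos ⟨⟨hi, by omega, by omega⟩, hk⟩, ← mul_assoc, ← mul_pow]
          simp
        · simp only [F]
          rw [if_neg (by tauto), mul_zero, add_zero]
          exact hM i p hi hip (by omega)
  obtain ⟨β, hβ, hM⟩ := key k
  exact ⟨β, hβ, fun i p hi hip => hM i p hi hip (by omega)⟩

/-- Symmetric matrices with vanishing row sums are determined by their superdiagonals. -/
lemma eq_of_superdiag_eq {k : ℕ} {M N : ℕ → ℕ → ℝ}
    (hM : ∀ p q, M p q = M q p) (hN : ∀ p q, N p q = N q p)
    (hM0 : ∀ p ≤ k, ∑ q ∈ Finset.range (k + 1), M p q = 0)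
    (hN0 : ∀ p ≤ k, ∑ q ∈ Finset.range (k + 1), N p q = 0)
    (h : ∀ i p, 1 ≤ i → i + p ≤ k → M p (p + i) = N p (p + i))
    {p q : ℕ} (hp : p ≤ k) (hq : q ≤ k) : M p q = N p q := by
  have off : ∀ p q, p ≤ k → q ≤ k → p ≠ q → M p q = N p q := by
    intro p q hp hq hpq
    rcases lt_or_gt_of_ne hpq with hlt | hlt
    · have := h (q - p) p (by omega) (by omega)
      rwa [Nat.add_sub_cancel' hlt.le] at this
    · have := h (p - q) q (by omega) (by omega)
      rw [Nat.add_sub_cancel' hlt.le] at this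
      rw [hM, hN, this]
  by_cases hpq : p = q
  · subst hpq
    have hs : ∑ r ∈ Finset.range (k + 1), (M p r - N p r) = 0 := by
      rw [Finset.sum_sub_distrib, hM0 p hp, hN0 p hp, sub_zero]
    rw [Finset.sum_eq_single p] at hs
    · linarith
    · intro r hr hrp
      rw [off p r hp (by simpa [Nat.lt_succ_iff] using hr) (Ne.symm hrp), sub_self]
    · intro hn
      exact absurd (Finset.mem_range.2 (by omega)) hn
  · exact off p q hp hq hpq

lemma sum_alternating_choose_div (k : ℕ) :
    ∑ i ∈ Finset.range k, (-1 : ℝ) ^ (i + 1) / ((i + 1 : ℕ) : ℝ) * (k.choose (i + 1))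
      = -∑ r ∈ Finset.Icc 1 k, (1 : ℝ) / r := by
  induction k with
  | zero => simp
  | succ k ih =>
    rw [Finset.sum_Icc_succ_top (by omega)]
    have hsplit : ∀ i ∈ Finset.range (k + 1),
        (-1 : ℝ) ^ (i + 1) / ((i + 1 : ℕ) : ℝ) * ((k + 1).choose (i + 1))
        = (-1 : ℝ) ^ (i + 1) / ((i + 1 : ℕ) : ℝ) * (k.choose (i + 1))
          + 1 / ((k + 1 : ℕ) : ℝ) * ((-1 : ℝ) ^ (i + 1) * ((k + 1).choose (i + 1))) := by
      intro i _
      have h1 : ((k + 1).choose (i + 1) : ℝ) = k.choose i + k.choose (i + 1) := by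
        exact_mod_cast Nat.choose_succ_succ k i
      have h2 : ((k + 1 : ℕ) : ℝ) * (k.choose i) = ((k + 1).choose (i + 1)) * ((i + 1 : ℕ) : ℝ) := by
        exact_mod_cast Nat.add_one_mul_choose_eq k i
      have hi : ((i + 1 : ℕ) : ℝ) ≠ 0 := by positivity
      have hk : ((k + 1 : ℕ) : ℝ) ≠ 0 := by positivity
      have h3 : ((k + 1).choose (i + 1) : ℝ) / ((k + 1 : ℕ) : ℝ)
          = (k.choose i) / ((i + 1 : ℕ) : ℝ) := by
        rw [div_eq_div_iff hk hi, ← h2, mul_comm]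
      calc (-1 : ℝ) ^ (i + 1) / ((i + 1 : ℕ) : ℝ) * ((k + 1).choose (i + 1))
          = (-1 : ℝ) ^ (i + 1) / ((i + 1 : ℕ) : ℝ) * (k.choose (i + 1))
            + (-1 : ℝ) ^ (i + 1) * ((k.choose i) / ((i + 1 : ℕ) : ℝ)) := by rw [h1]; ring
        _ = _ := by rw [← h3]; ring
    have halt := sum_alternating_choose (j := k + 1) (by omega)
    rw [Finset.sum_range_succ'] at halt
    rw [Finset.sum_congr rfl hsplit, Finset.sum_add_distrib, ← Finset.mul_sum,
      Finset.sum_range_succ _ k, ih, eq_neg_of_add_eq_zero_left halt]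
    simp
    ring

lemma sum_bdfDelta (k : ℕ) : ∑ i ∈ Finset.range (k + 1), bdfDelta k i = 0 := by
  rw [Finset.sum_range_succ']
  have := sum_alternating_choose_div k
  simp only [bdfDelta, Nat.succ_ne_zero, if_false, if_true]
  rw [this]
  ring

lemma sum_extrapCoeff_mul (k : ℕ) (x : ℕ → ℝ) :
    ∑ q ∈ Finset.range (k + 1), extrapCoeff k q * x q
      = ∑ j ∈ Finset.range k, bdfGamma k j * x (j + 1) := by
  rw [Finset.sum_range_succ']
  simp [extrapCoeff]

lemma sum_extrapCoeff {k : ℕ} (hk : 1 ≤ k) :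
    ∑ q ∈ Finset.range (k + 1), extrapCoeff k q = 1 := by
  have h := sum_extrapCoeff_mul k (fun _ => 1)
  have halt := sum_alternating_choose hk
  rw [Finset.sum_range_succ'] at halt
  simp only [mul_one] at h
  have hneg : ∑ j ∈ Finset.range k, bdfGamma k j
      = -∑ j ∈ Finset.range k, (-1 : ℝ) ^ (j + 1) * (k.choose (j + 1)) := by
    rw [← Finset.sum_neg_distrib]
    refine Finset.sum_congr rfl fun j _ => ?_
    rw [bdfGamma]
    ring
  rw [h, hneg, eq_neg_of_add_eq_zero_left halt]
  simp

lemma bdfMatrix_symm (k p q : ℕ) : bdfMatrix k p q = bdfMatrix k q p := by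
  unfold bdfMatrix
  by_cases h : p = q
  · rw [h]
  · rw [if_neg h, if_neg (Ne.symm h), add_comm]

lemma sum_bdfMatrix {k p : ℕ} (hk : 1 ≤ k) (hp : p ≤ k) :
    ∑ q ∈ Finset.range (k + 1), bdfMatrix k p q = 0 := by
  unfold bdfMatrix
  rw [Finset.sum_sub_distrib, Finset.sum_add_distrib, ← Finset.mul_sum, ← Finset.sum_mul,
    sum_extrapCoeff hk, sum_bdfDelta, Finset.sum_ite_eq, if_pos (Finset.mem_range.2 (by omega))]
  ring

/-- The quadratic form of a matrix indexed by `{0, …, k}`. -/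
noncomputable def quadForm (k : ℕ) (M : ℕ → ℕ → ℝ) (x : ℕ → ℝ) : ℝ :=
  ∑ p ∈ Finset.range (k + 1), ∑ q ∈ Finset.range (k + 1), M p q * (x p * x q)

lemma quadForm_bdfMatrix (k : ℕ) (x : ℕ → ℝ) :
    quadForm k (bdfMatrix k) x
      = ∑ j ∈ Finset.range (k + 1), bdfDelta k j * x j ^ 2
        - 2 * (∑ j ∈ Finset.range (k + 1), bdfDelta k j * x j)
          * (∑ j ∈ Finset.range k, bdfGamma k j * x (j + 1)) := by
  have h : ∀ p ∈ Finset.range (k + 1),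
      ∑ q ∈ Finset.range (k + 1), bdfMatrix k p q * (x p * x q)
      = bdfDelta k p * x p ^ 2
        - (bdfDelta k p * x p * ∑ q ∈ Finset.range (k + 1), extrapCoeff k q * x q
          + extrapCoeff k p * x p * ∑ q ∈ Finset.range (k + 1), bdfDelta k q * x q) := by
    intro p hp
    have hd : bdfDelta k p * x p ^ 2
        = ∑ q ∈ Finset.range (k + 1), if p = q then bdfDelta k p * x p * x q else 0 := by
      rw [Finset.sum_ite_eq, if_pos hp]
      ring
    rw [hd, Finset.mul_sum, Finset.mul_sum, ← Finset.sum_add_distrib, ← Finset.sum_sub_distrib]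
    refine Finset.sum_congr rfl fun q _ => ?_
    unfold bdfMatrix
    split_ifs <;> ring
  rw [quadForm, Finset.sum_congr rfl h, Finset.sum_sub_distrib, Finset.sum_add_distrib,
    ← Finset.sum_mul, ← Finset.sum_mul, ← sum_extrapCoeff_mul]
  ring

lemma quadForm_diffMatrix (k : ℕ) (β : ℕ → ℕ → ℝ) (x : ℕ → ℝ) :
    quadForm k (diffMatrix k β) x
      = ∑ j ∈ Finset.Icc 1 k, ∑ l ∈ Finset.range (k - j + 1),
          β j l * (∑ m ∈ Finset.range (j + 1), (-1 : ℝ) ^ m * (j.choose m) * x (l + m)) ^ 2 := by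
  have h : ∀ j ∈ Finset.Icc 1 k, ∀ l ∈ Finset.range (k - j + 1),
      β j l * (∑ m ∈ Finset.range (j + 1), (-1 : ℝ) ^ m * (j.choose m) * x (l + m)) ^ 2
      = ∑ p ∈ Finset.range (k + 1), ∑ q ∈ Finset.range (k + 1),
          β j l * (diffCoeff j l p * diffCoeff j l q) * (x p * x q) := by
    intro j hj l hl
    rw [Finset.mem_Icc] at hj
    rw [Finset.mem_range] at hl
    rw [← sum_diffCoeff_mul (k := k) (by omega), sq, Finset.sum_mul_sum, Finset.mul_sum]
    refine Finset.sum_congr rfl fun p _ => ?_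
    rw [Finset.mul_sum]
    refine Finset.sum_congr rfl fun q _ => ?_
    ring
  rw [Finset.sum_congr rfl fun j hj => Finset.sum_congr rfl (h j hj)]
  simp only [quadForm, diffMatrix, Finset.sum_mul]
  symm
  calc _ = ∑ j ∈ Finset.Icc 1 k, ∑ p ∈ Finset.range (k + 1), ∑ q ∈ Finset.range (k + 1),
        ∑ l ∈ Finset.range (k - j + 1),
          β j l * (diffCoeff j l p * diffCoeff j l q) * (x p * x q) := by
        refine Finset.sum_congr rfl fun j _ => ?_
        rw [Finset.sum_comm]
        exact Finset.sum_congr rfl fun p _ => Finset.sum_comm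
    _ = _ := by
        rw [Finset.sum_comm]
        exact Finset.sum_congr rfl fun p _ => Finset.sum_comm

lemma quadForm_sub (k : ℕ) (M N : ℕ → ℕ → ℝ) (x : ℕ → ℝ) :
    quadForm k (fun p q => M p q - N p q) x = quadForm k M x - quadForm k N x := by
  simp [quadForm, sub_mul, Finset.sum_sub_distrib]

/-- A symmetric matrix is determined by its quadratic form. -/
lemma eq_zero_of_quadForm_eq_zero {k : ℕ} {M : ℕ → ℕ → ℝ} (hM : ∀ p q, M p q = M q p)
    (h : ∀ x, quadForm k M x = 0) {r s : ℕ} (hr : r ≤ k) (hs : s ≤ k) : M r s = 0 := by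
  have e : ∀ (c d : ℝ), c ^ 2 * M r r + 2 * (c * d) * M r s + d ^ 2 * M s s = 0 := by
    intro c d
    have hx := h (fun p => (if p = r then c else 0) + if p = s then d else 0)
    have hr1 : r < k + 1 := by omega
    have hs1 : s < k + 1 := by omega
    simp only [quadForm, mul_add, add_mul, Finset.sum_add_distrib, mul_ite, ite_mul, mul_zero,
      zero_mul, Finset.sum_ite_eq', Finset.mem_range, hr1, hs1, if_true] at hx
    rw [hM s r] at hx
    linear_combination hx
  linarith [e 1 1, e 1 0, e 0 1]

lemma bdf_identity_iff_quadForm_eq (k : ℕ) (β : ℕ → ℕ → ℝ) :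
    (∀ (a : ℕ → ℝ) (n : ℕ), k ≤ n →
        ∑ j ∈ Finset.range (k + 1), bdfDelta k j * a (n - j) ^ 2
          - 2 * (∑ j ∈ Finset.range (k + 1), bdfDelta k j * a (n - j))
              * (∑ j ∈ Finset.range k, bdfGamma k j * a (n - j - 1))
        = ∑ j ∈ Finset.Icc 1 k, ∑ ℓ ∈ Finset.range (k - j + 1),
            β j ℓ * (∑ m ∈ Finset.range (j + 1),
              (-1 : ℝ) ^ m * (j.choose m) * a (n - ℓ - m)) ^ 2)
      ↔ ∀ x, quadForm k (bdfMatrix k) x = quadForm k (diffMatrix k β) x := by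
  constructor
  · intro h x
    have hx : ∀ M, quadForm k M x = quadForm k M (fun p => x (k - (k - p))) := by
      intro M
      refine Finset.sum_congr rfl fun p hp => Finset.sum_congr rfl fun q hq => ?_
      rw [Finset.mem_range] at hp hq
      simp only [Nat.sub_sub_self (show p ≤ k by omega), Nat.sub_sub_self (show q ≤ k by omega)]
    have := h (fun i => x (k - i)) k le_rfl
    rw [hx, hx, quadForm_bdfMatrix, quadForm_diffMatrix]
    simpa only [Nat.sub_sub] using this
  · intro h a n _
    have := h (fun p => a (n - p))
    rw [quadForm_bdfMatrix, quadForm_diffMatrix] at this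
    simpa only [Nat.sub_sub] using this

/-- Key algebraic identity for BDF-`k` schemes: existence and uniqueness of the
coefficients `β_{jℓ}` (supported on `1 ≤ j ≤ k`, `0 ≤ ℓ ≤ k - j`) such that for
every real sequence `a` and every `n ≥ k`,
`∑_{j=0}^{k} δ_j a_{n-j}² − 2 (∑_{j=0}^{k} δ_j a_{n-j}) (∑_{j=0}^{k-1} γ_j a_{n-j-1})
  = ∑_{j=1}^{k} ∑_{ℓ=0}^{k-j} β_{jℓ} (∑_{m=0}^{j} (−1)^m binom(j,m) a_{n-ℓ-m})²`. -/
theorem bdf_key_algebraic_identity_exists_unique (k : ℕ) (hk : 1 ≤ k) :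
    ∃! β : ℕ → ℕ → ℝ,
      (∀ j ℓ : ℕ, ¬(1 ≤ j ∧ j ≤ k ∧ ℓ ≤ k - j) → β j ℓ = 0) ∧
      (∀ (a : ℕ → ℝ) (n : ℕ), k ≤ n →
        ∑ j ∈ Finset.range (k + 1), bdfDelta k j * a (n - j) ^ 2
          - 2 * (∑ j ∈ Finset.range (k + 1), bdfDelta k j * a (n - j))
              * (∑ j ∈ Finset.range k, bdfGamma k j * a (n - j - 1))
        = ∑ j ∈ Finset.Icc 1 k, ∑ ℓ ∈ Finset.range (k - j + 1),
            β j ℓ * (∑ m ∈ Finset.range (j + 1),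
              (-1 : ℝ) ^ m * (j.choose m) * a (n - ℓ - m)) ^ 2) := by
  simp only [bdf_identity_iff_quadForm_eq]
  obtain ⟨β, hβ, hM⟩ := exists_diffMatrix_superdiag k (bdfMatrix k)
  refine ⟨β, ⟨hβ, fun x => ?_⟩, fun β' ⟨hβ', h'⟩ => ?_⟩
  · refine Finset.sum_congr rfl fun p hp => Finset.sum_congr rfl fun q hq => ?_
    rw [Finset.mem_range] at hp hq
    rw [eq_of_superdiag_eq (bdfMatrix_symm k) (diffMatrix_symm k β)
      (fun _ => sum_bdfMatrix hk) (fun p _ => sum_diffMatrix k β p)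
      (fun i p hi hip => (hM i p hi hip).symm) (show p ≤ k by omega) (show q ≤ k by omega)]
  · refine sub_eq_zero.1 (eq_zero_of_diffMatrix_eq_zero (k := k) (fun j l h => ?_)
      fun i p hi hip => ?_)
    · simp [hβ j l h, hβ' j l h]
    · have h0 := eq_zero_of_quadForm_eq_zero (k := k)
        (M := fun p q => bdfMatrix k p q - diffMatrix k β' p q)
        (fun p q => by rw [bdfMatrix_symm, diffMatrix_symm])
        (fun x => by rw [quadForm_sub, h' x, sub_self])
        (show p ≤ k by omega) (show p + i ≤ k by omega)
      rw [diffMatrix_sub, hM i p hi hip]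
      linarith
end

section
/- BDF-3 algebraic identity for symmetric bilinear maps: Let V and Z be real vector spaces, B : V×V→Z a symmetric bilinear map, and s>0. For any u^n, u^{n-1}, u^{n-2}, u^{n-3} ∈ V, set u̇^n := (11u^n − 18u^{n-1} + 9u^{n-2} − 2u^{n-3})/(6s), û^n := 3u^{n-1} − 3u^{n-2} + u^{n-3}, d_t³u^n := (u^n − 3u^{n-1} + 3u^{n-2} − u^{n-3})/s³, and d_t²u^{n-1} := (u^{n-1} − 2u^{n-2} + u^{n-3})/s². Then (11/6)B(u^n,u^n) − 3B(u^{n-1},u^{n-1}) + (3/2)B(u^{n-2},u^{n-2}) − (1/3)B(u^{n-3},u^{n-3}) − 2s·B(u̇^n, û^n) = (11/6)·s⁶·B(d_t³u^n, d_t³u^n) − (3/2)·s⁴·B(d_t²u^{n-1}, d_t²u^{n-1}). -/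
/-- BDF-3 algebraic identity for symmetric bilinear maps.  Here `u0, u1, u2, u3`
play the roles of `u^n, u^{n-1}, u^{n-2}, u^{n-3}`. -/
theorem bdf3_algebraic_identity
    {V Z : Type*} [AddCommGroup V] [Module ℝ V] [AddCommGroup Z] [Module ℝ Z]
    (B : V →ₗ[ℝ] V →ₗ[ℝ] Z)
    (hBsymm : ∀ u v : V, B u v = B v u)
    (s : ℝ) (hs : 0 < s)
    (u0 u1 u2 u3 : V) :
    (11 / 6 : ℝ) • B u0 u0 - (3 : ℝ) • B u1 u1 + (3 / 2 : ℝ) • B u2 u2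
      - (1 / 3 : ℝ) • B u3 u3
      - (2 * s) • B ((6 * s)⁻¹ •
            ((11 : ℝ) • u0 - (18 : ℝ) • u1 + (9 : ℝ) • u2 - (2 : ℝ) • u3))
          ((3 : ℝ) • u1 - (3 : ℝ) • u2 + u3)
    = ((11 / 6 : ℝ) * s ^ 6) •
        B ((s ^ 3)⁻¹ • (u0 - (3 : ℝ) • u1 + (3 : ℝ) • u2 - u3))
          ((s ^ 3)⁻¹ • (u0 - (3 : ℝ) • u1 + (3 : ℝ) • u2 - u3))
      - ((3 / 2 : ℝ) * s ^ 4) •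
        B ((s ^ 2)⁻¹ • (u1 - (2 : ℝ) • u2 + u3))
          ((s ^ 2)⁻¹ • (u1 - (2 : ℝ) • u2 + u3)) := by
  have h₁ : 2 * s * (6 * s)⁻¹ = 1 / 3 := by field_simp; norm_num
  have h₂ : 11 / 6 * s ^ 6 * ((s ^ 3)⁻¹ * (s ^ 3)⁻¹) = 11 / 6 := by field_simp
  have h₃ : 3 / 2 * s ^ 4 * ((s ^ 2)⁻¹ * (s ^ 2)⁻¹) = 3 / 2 := by field_simp
  simp only [map_smul (B _) (_)⁻¹, map_smul B (_)⁻¹, LinearMap.smul_apply _⁻¹, smul_smul,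
    h₁, h₂, h₃]
  simp only [map_add, map_sub, map_smul, LinearMap.add_apply, LinearMap.sub_apply,
    LinearMap.smul_apply]
  rw [hBsymm u1 u0, hBsymm u2 u0, hBsymm u3 u0, hBsymm u2 u1, hBsymm u3 u1, hBsymm u3 u2]
  module
end

section
/- BDF-4 algebraic identity for symmetric bilinear maps: Let V and Z be real vector spaces, B : V×V→Z a symmetric bilinear map, and s>0. For any u^n, u^{n-1}, u^{n-2}, u^{n-3}, u^{n-4} ∈ V, set u̇^n := (25u^n − 48u^{n-1} + 36u^{n-2} − 16u^{n-3} + 3u^{n-4})/(12s), û^n := 4u^{n-1} − 6u^{n-2} + 4u^{n-3} − u^{n-4}, d_t⁴u^n := (u^n − 4u^{n-1} + 6u^{n-2} − 4u^{n-3} + u^{n-4})/s⁴, d_t³u^{n-1} := (u^{n-1} − 3u^{n-2} + 3u^{n-3} − u^{n-4})/s³, d_t²u^{n-1} := (u^{n-1} − 2u^{n-2} + u^{n-3})/s², and d_t²u^{n-2} := (u^{n-2} − 2u^{n-3} + u^{n-4})/s². Then (25/12)B(u^n,u^n) − 4B(u^{n-1},u^{n-1}) + 3B(u^{n-2},u^{n-2})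 − (4/3)B(u^{n-3},u^{n-3}) + (1/4)B(u^{n-4},u^{n-4}) − 2s·B(u̇^n, û^n) = (25/12)·s⁸·B(d_t⁴u^n, d_t⁴u^n) − (10/3)·s⁶·B(d_t³u^{n-1}, d_t³u^{n-1}) − 2·s⁴·B(d_t²u^{n-1}, d_t²u^{n-1}) + 2·s⁴·B(d_t²u^{n-2}, d_t²u^{n-2}). -/
/-- BDF-4 algebraic identity for symmetric bilinear maps.  Here
`u0, u1, u2, u3, u4` play the roles of `u^n, u^{n-1}, u^{n-2}, u^{n-3}, u^{n-4}`. -/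
theorem bdf4_algebraic_identity
    {V Z : Type*} [AddCommGroup V] [Module ℝ V] [AddCommGroup Z] [Module ℝ Z]
    (B : V →ₗ[ℝ] V →ₗ[ℝ] Z)
    (hBsymm : ∀ u v : V, B u v = B v u)
    (s : ℝ) (hs : 0 < s)
    (u0 u1 u2 u3 u4 : V) :
    (25 / 12 : ℝ) • B u0 u0 - (4 : ℝ) • B u1 u1 + (3 : ℝ) • B u2 u2
      - (4 / 3 : ℝ) • B u3 u3 + (1 / 4 : ℝ) • B u4 u4
      - (2 * s) • B ((12 * s)⁻¹ •
            ((25 : ℝ) • u0 - (48 : ℝ) • u1 + (36 : ℝ) • u2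
              - (16 : ℝ) • u3 + (3 : ℝ) • u4))
          ((4 : ℝ) • u1 - (6 : ℝ) • u2 + (4 : ℝ) • u3 - u4)
    = ((25 / 12 : ℝ) * s ^ 8) •
        B ((s ^ 4)⁻¹ • (u0 - (4 : ℝ) • u1 + (6 : ℝ) • u2 - (4 : ℝ) • u3 + u4))
          ((s ^ 4)⁻¹ • (u0 - (4 : ℝ) • u1 + (6 : ℝ) • u2 - (4 : ℝ) • u3 + u4))
      - ((10 / 3 : ℝ) * s ^ 6) •
        B ((s ^ 3)⁻¹ • (u1 - (3 : ℝ) • u2 + (3 : ℝ) • u3 - u4))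
          ((s ^ 3)⁻¹ • (u1 - (3 : ℝ) • u2 + (3 : ℝ) • u3 - u4))
      - ((2 : ℝ) * s ^ 4) •
        B ((s ^ 2)⁻¹ • (u1 - (2 : ℝ) • u2 + u3))
          ((s ^ 2)⁻¹ • (u1 - (2 : ℝ) • u2 + u3))
      + ((2 : ℝ) * s ^ 4) •
        B ((s ^ 2)⁻¹ • (u2 - (2 : ℝ) • u3 + u4))
          ((s ^ 2)⁻¹ • (u2 - (2 : ℝ) • u3 + u4)) := by
  have hs0 : s ≠ 0 := hs.ne'
  have rescale (c k : ℝ) (hk : k ≠ 0) (w : V) :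
      (c * k ^ 2) • B (k⁻¹ • w) (k⁻¹ • w) = c • B w w := by
    simp only [map_smul, LinearMap.smul_apply, smul_smul]
    congr 1
    field_simp
  have rescale_dot (v w : V) :
      (2 * s) • B ((12 * s)⁻¹ • v) w = (1 / 6 : ℝ) • B v w := by
    simp only [map_smul, LinearMap.smul_apply, smul_smul]
    congr 1
    field_simp
    norm_num
  rw [rescale_dot, show s ^ 8 = (s ^ 4) ^ 2 by ring, show s ^ 6 = (s ^ 3) ^ 2 by ring,
    rescale _ _ (pow_ne_zero 4 hs0), rescale _ _ (pow_ne_zero 3 hs0),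
    show (2 : ℝ) * s ^ 4 = 2 * (s ^ 2) ^ 2 by ring,
    rescale _ _ (pow_ne_zero 2 hs0), rescale _ _ (pow_ne_zero 2 hs0)]
  simp only [map_add, map_sub, map_smul, LinearMap.add_apply, LinearMap.sub_apply,
    LinearMap.smul_apply]
  rw [hBsymm u1 u0, hBsymm u2 u0, hBsymm u3 u0, hBsymm u4 u0, hBsymm u2 u1, hBsymm u3 u1,
    hBsymm u4 u1, hBsymm u3 u2, hBsymm u4 u2, hBsymm u4 u3]
  module
end

section
/- Exact expression of constraint violations for BDF-k projection-free schemes: Fix an integer k with 2≤k≤6 and s>0. Let V and Z be real vector spaces, B : V×V→Z a symmetric bilinear map, u_c∈Z, and let (u^n)_{n≥0} be a sequence in V such that B(u⁰,u⁰) = u_c and the linearized constraint B(u̇^n, û^n) = 0 holds for all n≥k, where u̇^n := (1/s)∑_{j=0}^{k} δ_j u^{n-j} and û^n := ∑_{j=0}^{k-1} γ_j u^{n-j-1}. Set b_n := B(u^n,u^n) − u_c and φ_m := ∑_{j=0}^{k} δ_j B(u^{m-j}, u^{m-j}). Then for every N≥k: b_N = ∑_{m=1}^{k-1} ( t̃δ_{k-1-m}·∑_{n=k}^{N}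 η_{N-n} − ∑_{ℓ=k-m}^{k-1} t̃δ_ℓ·η_{N-ℓ-m} )·b_m + ∑_{n=k}^{N} η_{N-n}·∑_{m=k}^{n} φ_m, with the convention η_j = 0 for j<0. -/
theorem bdfDelta_zero_pos {k : ℕ} (hk : 1 ≤ k) : 0 < bdfDelta k 0 := by
  rw [bdfDelta, if_pos rfl]
  refine Finset.sum_pos (fun r hr => ?_) ⟨1, by simpa using hk⟩
  have : 0 < r := (Finset.mem_Icc.mp hr).1
  positivity

/-- Consistency of the BDF-`k` coefficients: they sum to zero. -/
theorem bdfTildeDelta_self {k : ℕ} (hk2 : 2 ≤ k) (hk6 : k ≤ 6) : bdfTildeDelta k k = 0 := by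
  interval_cases k <;>
    norm_num [bdfTildeDelta, bdfDelta, Finset.sum_range_succ, Finset.sum_Icc_succ_top, Nat.choose]

theorem bdfTildeDelta_zero (k : ℕ) : bdfTildeDelta k 0 = bdfDelta k 0 :=
  Finset.sum_range_one _

theorem bdfTildeDelta_succ (k j : ℕ) :
    bdfTildeDelta k (j + 1) = bdfTildeDelta k j + bdfDelta k (j + 1) :=
  Finset.sum_range_succ _ _

section

variable {Z : Type*} [AddCommGroup Z] [Module ℝ Z]

/-- Subtracting a constant from a sequence does not change its BDF-`k` difference. -/
theorem sum_bdfDelta_smul_sub {k : ℕ} (hsum : bdfTildeDelta k k = 0) (a : ℕ → Z) (c : Z) (m : ℕ) :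
    ∑ j ∈ Finset.range (k + 1), bdfDelta k j • (a (m - j) - c)
      = ∑ j ∈ Finset.range (k + 1), bdfDelta k j • a (m - j) := by
  rw [bdfTildeDelta] at hsum
  simp_rw [smul_sub, Finset.sum_sub_distrib, ← Finset.sum_smul, hsum, zero_smul, sub_zero]

/-- Summation by parts for the BDF-`k` difference. -/
theorem sum_bdfDelta_smul_eq {k : ℕ} (hk : 1 ≤ k) (hsum : bdfTildeDelta k k = 0) (b : ℕ → Z)
    {n : ℕ} (hn : k - 1 ≤ n) :
    ∑ m ∈ Finset.Icc k n, ∑ j ∈ Finset.range (k + 1), bdfDelta k j • b (m - j)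
      = ∑ j ∈ Finset.range k, bdfTildeDelta k j • b (n - j)
        - ∑ j ∈ Finset.range k, bdfTildeDelta k j • b (k - 1 - j) := by
  induction n, hn using Nat.le_induction with
  | base => simp [Finset.Icc_eq_empty (show ¬k ≤ k - 1 by omega)]
  | succ n hn ih =>
    have step : ∑ j ∈ Finset.range k, bdfTildeDelta k j • b (n + 1 - j)
        = ∑ j ∈ Finset.range k, bdfTildeDelta k j • b (n - j)
          + ∑ j ∈ Finset.range (k + 1), bdfDelta k j • b (n + 1 - j) := by
      have h := Finset.sum_range_succ (fun j => bdfTildeDelta k j • b (n + 1 - j)) k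
      rw [hsum, zero_smul, add_zero] at h
      rw [← h, Finset.sum_range_succ', Finset.sum_range_succ', ← add_assoc,
        ← Finset.sum_add_distrib]
      simp [bdfTildeDelta_succ, bdfTildeDelta_zero, add_smul]
    rw [Finset.sum_Icc_succ_top (by omega), ih, step]
    abel

/-- The sequence `η` is the convolution inverse of the summed BDF-`k` coefficients, so convolving
with it recovers `b N` up to contributions of the initial values. -/
theorem sum_eta_smul_sum_bdfTildeDelta {k : ℕ} (hk : 1 ≤ k) {η : ℤ → ℝ}
    (hηneg : ∀ m : ℤ, m < 0 → η m = 0) (hη0 : η 0 = 1 / bdfTildeDelta k 0)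
    (hηrec : ∀ n : ℤ, 1 ≤ n → ∑ j ∈ Finset.range k, bdfTildeDelta k j * η (n - (j : ℤ)) = 0)
    (b : ℕ → Z) {N : ℕ} (hN : k ≤ N) :
    ∑ n ∈ Finset.Icc k N, η ((N : ℤ) - (n : ℤ)) •
        ∑ j ∈ Finset.range k, bdfTildeDelta k j • b (n - j)
      = b N + ∑ m ∈ Finset.Icc 1 (k - 1),
          (∑ ℓ ∈ Finset.Icc (k - m) (k - 1),
            bdfTildeDelta k ℓ * η ((N : ℤ) - (ℓ : ℤ) - (m : ℤ))) • b m := by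
  have hdelta : bdfTildeDelta k 0 ≠ 0 :=
    bdfTildeDelta_zero k ▸ (bdfDelta_zero_pos hk).ne'
  have reindex : ∀ j ∈ Finset.range k,
      ∑ n ∈ Finset.Icc k N, η ((N : ℤ) - (n : ℤ)) • bdfTildeDelta k j • b (n - j)
        = ∑ m ∈ Finset.Icc 1 N, if k ≤ m + j then
            (bdfTildeDelta k j * η ((N : ℤ) - (j : ℤ) - (m : ℤ))) • b m else 0 := by
    intro j hj
    rw [Finset.mem_range] at hj
    rw [← Finset.sum_filter]
    refine Finset.sum_of_injOn (fun n => n - j) ?_ ?_ ?_ ?_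
    · intro x hx y hy hxy
      simp only [Finset.coe_Icc, Set.mem_Icc] at hx hy hxy
      omega
    · intro x hx
      simp only [Finset.coe_Icc, Set.mem_Icc, Finset.coe_filter, Finset.mem_Icc,
        Set.mem_ofPred_eq] at hx ⊢
      omega
    · intro m hm hm'
      simp only [Finset.mem_filter, Finset.mem_Icc] at hm
      rw [hηneg, mul_zero, zero_smul]
      by_contra hlt
      exact hm' ⟨m + j, by simp only [Finset.coe_Icc, Set.mem_Icc]; omega, by simp⟩
    · intro n hn
      rw [Finset.mem_Icc] at hn
      rw [smul_smul, mul_comm, show (N : ℤ) - j - ((n - j : ℕ) : ℤ) = N - n by omega]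
  have full : ∀ m ∈ Finset.Icc k N,
      (∑ j ∈ Finset.range k, if k ≤ m + j then
        (bdfTildeDelta k j * η ((N : ℤ) - (j : ℤ) - (m : ℤ))) • b m else 0)
        = if m = N then b N else 0 := by
    intro m hm
    rw [Finset.mem_Icc] at hm
    have h : ∀ j ∈ Finset.range k, (if k ≤ m + j then
        (bdfTildeDelta k j * η ((N : ℤ) - (j : ℤ) - (m : ℤ))) • b m else 0)
        = (bdfTildeDelta k j * η (((N : ℤ) - m) - j)) • b m := fun j _ => by
      rw [if_pos (by omega), sub_right_comm]
    rw [Finset.sum_congr rfl h, ← Finset.sum_smul]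
    split_ifs with hmN
    · subst hmN
      rw [Finset.sum_eq_single_of_mem 0 (Finset.mem_range.mpr hk)]
      · simp [hη0, hdelta]
      · intro j _ hj
        rw [hηneg _ (by omega), mul_zero]
    · rw [hηrec _ (by omega), zero_smul]
  have initial : ∀ m ∈ Finset.Icc 1 (k - 1),
      (∑ j ∈ Finset.range k, if k ≤ m + j then
        (bdfTildeDelta k j * η ((N : ℤ) - (j : ℤ) - (m : ℤ))) • b m else 0)
        = (∑ ℓ ∈ Finset.Icc (k - m) (k - 1),
            bdfTildeDelta k ℓ * η ((N : ℤ) - (ℓ : ℤ) - (m : ℤ))) • b m := by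
    intro m hm
    rw [← Finset.sum_filter, Finset.sum_smul]
    refine Finset.sum_congr ?_ fun _ _ => rfl
    ext j
    simp only [Finset.mem_filter, Finset.mem_range, Finset.mem_Icc]
    omega
  have split : Finset.Icc 1 N = Finset.Icc k N ∪ Finset.Icc 1 (k - 1) := by
    ext m
    simp only [Finset.mem_union, Finset.mem_Icc]
    omega
  have disj : Disjoint (Finset.Icc k N) (Finset.Icc 1 (k - 1)) := by
    rw [Finset.disjoint_left]
    intro m hm hm'
    rw [Finset.mem_Icc] at hm hm'
    omega
  simp_rw [Finset.smul_sum]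
  rw [Finset.sum_comm, Finset.sum_congr rfl reindex, Finset.sum_comm, split,
    Finset.sum_union disj, Finset.sum_congr rfl full, Finset.sum_congr rfl initial,
    Finset.sum_ite_eq', if_pos (Finset.mem_Icc.mpr ⟨hN, le_rfl⟩)]

/-- The boundary term of the summation by parts, indexed by the time step. -/
theorem sum_bdfTildeDelta_smul_initial {k : ℕ} (hk : 1 ≤ k) {b : ℕ → Z} (hb0 : b 0 = 0) :
    ∑ j ∈ Finset.range k, bdfTildeDelta k j • b (k - 1 - j)
      = ∑ m ∈ Finset.Icc 1 (k - 1), bdfTildeDelta k (k - 1 - m) • b m := by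
  rw [← Finset.sum_range_reflect]
  symm
  refine Finset.sum_subset_zero_on_sdiff ?_ ?_ ?_
  · intro m hm
    rw [Finset.mem_Icc] at hm
    rw [Finset.mem_range]
    omega
  · intro m hm
    simp only [Finset.mem_sdiff, Finset.mem_range, Finset.mem_Icc] at hm
    obtain rfl : m = 0 := by omega
    simp [hb0]
  · intro m hm
    rw [Finset.mem_Icc] at hm
    rw [show k - 1 - (k - 1 - m) = m by omega]

end

/-- Exact expression of constraint violations for BDF-`k` projection-free schemes:
if the linearized constraint `B(u̇^n, û^n) = 0` holds for all `n ≥ k`, then the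
constraint violation `b_N = B(u^N, u^N) − u_c` satisfies the explicit formula in
terms of the initial violations `b_1, …, b_{k-1}` and the quadratic terms
`φ_m = ∑_{j=0}^k δ_j B(u^{m-j}, u^{m-j})`. -/
theorem bdfk_constraint_violation_exact_expression
    (k : ℕ) (hk2 : 2 ≤ k) (hk6 : k ≤ 6)
    {V Z : Type*} [AddCommGroup V] [Module ℝ V] [AddCommGroup Z] [Module ℝ Z]
    (B : V →ₗ[ℝ] V →ₗ[ℝ] Z)
    (hBsymm : ∀ u v : V, B u v = B v u)
    (u_c : Z) (s : ℝ) (hs : 0 < s)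
    (η : ℤ → ℝ)
    (hηneg : ∀ m : ℤ, m < 0 → η m = 0)
    (hη0 : η 0 = 1 / bdfTildeDelta k 0)
    (hηrec : ∀ n : ℤ, 1 ≤ n →
      ∑ j ∈ Finset.range k, bdfTildeDelta k j * η (n - (j : ℤ)) = 0)
    (u : ℕ → V)
    (hu0 : B (u 0) (u 0) = u_c)
    (hcons : ∀ n, k ≤ n →
      B (s⁻¹ • ∑ j ∈ Finset.range (k + 1), bdfDelta k j • u (n - j))
        (∑ j ∈ Finset.range k, bdfGamma k j • u (n - j - 1)) = 0) :
    ∀ N, k ≤ N →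
      B (u N) (u N) - u_c
        = ∑ m ∈ Finset.Icc 1 (k - 1),
            (bdfTildeDelta k (k - 1 - m) * ∑ n ∈ Finset.Icc k N, η ((N : ℤ) - (n : ℤ))
              - ∑ ℓ ∈ Finset.Icc (k - m) (k - 1),
                  bdfTildeDelta k ℓ * η ((N : ℤ) - (ℓ : ℤ) - (m : ℤ)))
            • (B (u m) (u m) - u_c)
          + ∑ n ∈ Finset.Icc k N, η ((N : ℤ) - (n : ℤ))
              • ∑ m ∈ Finset.Icc k n,
                  ∑ j ∈ Finset.range (k + 1), bdfDelta k j • B (u (m - j)) (u (m - j)) := by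
  intro N hN
  have hk : 1 ≤ k := by omega
  have hsum := bdfTildeDelta_self hk2 hk6
  set b : ℕ → Z := fun n => B (u n) (u n) - u_c with hb
  have hφ : ∀ n ∈ Finset.Icc k N,
      η ((N : ℤ) - (n : ℤ)) • ∑ m ∈ Finset.Icc k n,
        ∑ j ∈ Finset.range (k + 1), bdfDelta k j • B (u (m - j)) (u (m - j))
      = η ((N : ℤ) - (n : ℤ)) • ∑ j ∈ Finset.range k, bdfTildeDelta k j • b (n - j)
        - η ((N : ℤ) - (n : ℤ)) •
          ∑ m ∈ Finset.Icc 1 (k - 1), bdfTildeDelta k (k - 1 - m) • b m := by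
    intro n hn
    rw [Finset.mem_Icc] at hn
    rw [← smul_sub, ← sum_bdfTildeDelta_smul_initial hk (by simp [hb, hu0]),
      ← sum_bdfDelta_smul_eq hk hsum b (by omega)]
    simp_rw [hb, sum_bdfDelta_smul_sub hsum (fun i => B (u i) (u i))]
  change b N = ∑ m ∈ Finset.Icc 1 (k - 1), _ • b m + _
  rw [Finset.sum_congr rfl hφ, Finset.sum_sub_distrib,
    sum_eta_smul_sum_bdfTildeDelta hk hηneg hη0 hηrec b hN, ← Finset.sum_smul, Finset.smul_sum]
  simp_rw [sub_smul, Finset.sum_sub_distrib, smul_smul, mul_comm (∑ n ∈ Finset.Icc k N, _)]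
  abel
end

section
/- G-stability identity for the BDF-2 derivative: Let V be a real vector space, M : V×V→ℝ a symmetric bilinear form, and s>0. For u^n, u^{n-1}, u^{n-2} ∈ V define u̇^n := (3u^n − 4u^{n-1} + u^{n-2})/(2s), d_t²u^n := (u^n − 2u^{n-1} + u^{n-2})/s², and G_M(u,v) := M(u−v, u−v) + (3/2)M(u,u) − (1/2)M(v,v). Then 2s·M(u̇^n, u^n) = G_M(u^n, u^{n-1}) − G_M(u^{n-1}, u^{n-2}) + (s⁴/2)·M(d_t²u^n, d_t²u^n). -/
/-- The BDF-2 adapted bilinear form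
`G_M(u, v) = M(u − v, u − v) + (3/2) M(u, u) − (1/2) M(v, v)`. -/
noncomputable def GM {V : Type*} [AddCommGroup V] [Module ℝ V]
    (M : V →ₗ[ℝ] V →ₗ[ℝ] ℝ) (u v : V) : ℝ :=
  M (u - v) (u - v) + 3 / 2 * M u u - 1 / 2 * M v v

/-- G-stability identity for the BDF-2 derivative.  Here `u0, u1, u2` play the
roles of `u^n, u^{n-1}, u^{n-2}`. -/
theorem bdf2_G_stability_identity
    {V : Type*} [AddCommGroup V] [Module ℝ V]
    (M : V →ₗ[ℝ] V →ₗ[ℝ] ℝ)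
    (hMsymm : ∀ u v : V, M u v = M v u)
    (s : ℝ) (hs : 0 < s)
    (u0 u1 u2 : V) :
    2 * s * M ((2 * s)⁻¹ • ((3 : ℝ) • u0 - (4 : ℝ) • u1 + u2)) u0
      = GM M u0 u1 - GM M u1 u2
        + s ^ 4 / 2 * M ((s ^ 2)⁻¹ • (u0 - (2 : ℝ) • u1 + u2))
            ((s ^ 2)⁻¹ • (u0 - (2 : ℝ) • u1 + u2)) := by
  have hs0 : s ≠ 0 := hs.ne'
  simp only [GM, map_smul, map_add, map_sub, LinearMap.smul_apply, LinearMap.add_apply,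
    LinearMap.sub_apply, smul_eq_mul]
  rw [hMsymm u1 u0, hMsymm u2 u0, hMsymm u2 u1]
  field_simp
  ring
end

section
/- Initialization step estimates for the BDF-2 accelerated gradient flow: Let U be a real Hilbert space and M : U×U→ℝ a symmetric positive semidefinite bilinear form. Fix s>0 and α>0, let u⁰∈U, let V ⊆ U be a linear subspace, and suppose v ∈ V satisfies ⟨v/s, w⟩_U + (α/s)⟨v, w⟩_U + M(u⁰ + s·v, w) = 0 for all w ∈ V (the BDF-1 step with zero initial velocity, where v plays the role of d_t u¹). Set u¹ := u⁰ + s·v. Then: (i) ‖v‖²_U ≤ (1/(2α))·M(u⁰,u⁰); and (ii) G_M(u¹, u⁰) ≤ 2λ₂·M(u⁰,u⁰), where G_M(u,v) := M(u−v,u−v) + (3/2)M(u,u) − (1/2)M(v,v) and λ₂ := (3 + 2√2)/2. -/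
open scoped RealInnerProductSpace

/-- Initialization step estimates for the BDF-2 accelerated gradient flow:
one BDF-1 step with zero initial velocity, where `v` plays the role of `d_t u¹`
and `u¹ = u⁰ + s • v`. -/
theorem bdf2_initialization_step_estimates
    {U : Type*} [NormedAddCommGroup U] [InnerProductSpace ℝ U]
    (M : U →ₗ[ℝ] U →ₗ[ℝ] ℝ)
    (hMsymm : ∀ u v : U, M u v = M v u)
    (hMpos : ∀ u : U, 0 ≤ M u u)
    (s α : ℝ) (hs : 0 < s) (hα : 0 < α)
    (u0 : U) (V : Submodule ℝ U) (v : U) (hv : v ∈ V)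
    (heq : ∀ w ∈ V,
      ⟪s⁻¹ • v, w⟫ + (α / s) * ⟪v, w⟫ + M (u0 + s • v) w = 0) :
    ‖v‖ ^ 2 ≤ 1 / (2 * α) * M u0 u0 ∧
    GM M (u0 + s • v) u0 ≤ 2 * ((3 + 2 * Real.sqrt 2) / 2) * M u0 u0 := by
  have hstep : (1 + α) * ‖v‖ ^ 2 + s * M u0 v + s ^ 2 * M v v = 0 := by
    have h := heq v hv
    simp only [real_inner_smul_left, real_inner_self_eq_norm_sq, map_add, map_smul,
      LinearMap.add_apply, LinearMap.smul_apply, smul_eq_mul] at h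
    field_simp at h
    linarith
  have hexpand : M (u0 + s • v) (u0 + s • v) =
      M u0 u0 + 2 * (s * M u0 v) + s ^ 2 * M v v := by
    simp only [map_add, map_smul, LinearMap.add_apply, LinearMap.smul_apply, smul_eq_mul,
      hMsymm v u0]
    ring
  have hincr : M (s • v) (s • v) = s ^ 2 * M v v := by
    simp only [map_smul, LinearMap.smul_apply, smul_eq_mul]
    ring
  have hu1 := hMpos (u0 + s • v)
  have hsv := hMpos (s • v)
  rw [hexpand] at hu1
  rw [hincr] at hsv
  have hv2 : 0 ≤ ‖v‖ ^ 2 := sq_nonneg _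
  have hαv : 0 ≤ α * ‖v‖ ^ 2 := by positivity
  constructor
  · rw [one_div_mul_eq_div, le_div_iff₀ (by positivity)]
    linarith
  · have hsqrt : 0 ≤ Real.sqrt 2 * M u0 u0 := mul_nonneg (Real.sqrt_nonneg 2) (hMpos u0)
    rw [GM, add_sub_cancel_left, hexpand, hincr]
    linarith [hMpos u0]
end

section
/- Transition step estimates for the BDF-2 accelerated gradient flow: Let U be a real Hilbert space and M : U×U→ℝ a symmetric positive semidefinite bilinear form. Fix s>0 and α>0, let u⁰∈U, let V₁ ⊆ U be a linear subspace and v ∈ V₁ satisfy ⟨v/s, w⟩_U + (α/s)⟨v, w⟩_U + M(u⁰ + s·v, w) = 0 for all w ∈ V₁; set u¹ := u⁰ + s·v. Let V₂ ⊆ U be a linear subspace and u̇² ∈ V₂ satisfy ⟨(u̇² − v)/s, w⟩_U + (α/(2s))⟨u̇², w⟩_U + (1/3)·M(4u¹ − u⁰ + 2s·u̇², w) = 0 for all w ∈ V₂; set u² := (4u¹ − u⁰ + 2s·u̇²)/3. Then: (i) ‖u̇²‖²_U + G_M(u², u¹) ≤ (2λ₂ + 1/(2α))·M(u⁰,u⁰);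 and (ii) ‖u̇²‖²_U ≤ (1/(2α²) + 2λ₂/α)·M(u⁰,u⁰), where G_M(u,v) := M(u−v,u−v) + (3/2)M(u,u) − (1/2)M(v,v) and λ₂ := (3 + 2√2)/2. -/
open scoped RealInnerProductSpace

/-- Twice the BDF-1 pairing of a symmetric form splits into an increment plus a square. -/
lemma two_mul_apply_sub_self {V : Type*} [AddCommGroup V] [Module ℝ V]
    (M : V →ₗ[ℝ] V →ₗ[ℝ] ℝ) (hM : ∀ u v : V, M u v = M v u) (b c : V) :
    2 * M b (b - c) = M b b - M c c + M (b - c) (b - c) := by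
  simp only [map_sub, LinearMap.sub_apply, hM c b]
  ring

/-- The G-stability identity of the BDF-2 difference formula. -/
lemma apply_bdf2_eq_GM_sub_GM {V : Type*} [AddCommGroup V] [Module ℝ V]
    (M : V →ₗ[ℝ] V →ₗ[ℝ] ℝ) (hM : ∀ u v : V, M u v = M v u) (a b c : V) :
    M a ((3 : ℝ) • a - (4 : ℝ) • b + c) =
      GM M a b - GM M b c
        + 1 / 2 * M (a - (2 : ℝ) • b + c) (a - (2 : ℝ) • b + c) := by
  simp only [GM, map_sub, map_add, map_smul, LinearMap.sub_apply, LinearMap.add_apply,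
    LinearMap.smul_apply, smul_eq_mul, hM b a, hM c a, hM c b]
  ring

lemma GM_nonneg {V : Type*} [AddCommGroup V] [Module ℝ V]
    (M : V →ₗ[ℝ] V →ₗ[ℝ] ℝ) (hM : ∀ u v : V, M u v = M v u)
    (hpos : ∀ u : V, 0 ≤ M u u) (a b : V) : 0 ≤ GM M a b := by
  have h1 := hpos a
  have h2 := hpos ((2 : ℝ) • a - b)
  simp only [GM, map_sub, map_smul, LinearMap.sub_apply,
    LinearMap.smul_apply, smul_eq_mul, hM b a] at h2 ⊢
  linarith

/-- The form `GM M` is bounded by its largest eigenvalue `(3 + 2√2) / 2`. -/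
lemma GM_le {V : Type*} [AddCommGroup V] [Module ℝ V]
    (M : V →ₗ[ℝ] V →ₗ[ℝ] ℝ) (hM : ∀ u v : V, M u v = M v u)
    (hpos : ∀ u : V, 0 ≤ M u u) (b c : V) :
    GM M b c ≤ (3 + 2 * Real.sqrt 2) / 2 * (M b b + M c c) := by
  have hr : Real.sqrt 2 * Real.sqrt 2 = 2 := Real.mul_self_sqrt (by norm_num)
  have hr1 : 0 ≤ Real.sqrt 2 - 1 := sub_nonneg.2 (Real.one_le_sqrt.2 (by norm_num))
  have h := mul_nonneg hr1 (hpos (b + (Real.sqrt 2 + 1) • c))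
  simp only [GM, map_sub, map_add, map_smul, LinearMap.sub_apply, LinearMap.add_apply,
    LinearMap.smul_apply, smul_eq_mul, hM c b] at h ⊢
  linear_combination h + (2 * M b c + (Real.sqrt 2 + 1) * M c c) * hr

/-- Transition step estimates for the BDF-2 accelerated gradient flow:
after the BDF-1 initialization step (`v` playing the role of `d_t u¹`,
`u¹ = u⁰ + s • v`) and the BDF-2 transition step (`udot2` playing the role of
the BDF-2 derivative `u̇²`, `u² = (4u¹ − u⁰ + 2s u̇²)/3`). -/
theorem bdf2_transition_step_estimates
    {U : Type*} [NormedAddCommGroup U] [InnerProductSpace ℝ U]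
    (M : U →ₗ[ℝ] U →ₗ[ℝ] ℝ)
    (hMsymm : ∀ u v : U, M u v = M v u)
    (hMpos : ∀ u : U, 0 ≤ M u u)
    (s α : ℝ) (hs : 0 < s) (hα : 0 < α)
    (u0 : U)
    (V1 : Submodule ℝ U) (v : U) (hv : v ∈ V1)
    (heq1 : ∀ w ∈ V1,
      ⟪s⁻¹ • v, w⟫ + (α / s) * ⟪v, w⟫ + M (u0 + s • v) w = 0)
    (u1 : U) (hu1 : u1 = u0 + s • v)
    (V2 : Submodule ℝ U) (udot2 : U) (hudot2 : udot2 ∈ V2)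
    (heq2 : ∀ w ∈ V2,
      ⟪s⁻¹ • (udot2 - v), w⟫ + (α / (2 * s)) * ⟪udot2, w⟫
        + 1 / 3 * M ((4 : ℝ) • u1 - u0 + (2 * s) • udot2) w = 0)
    (u2 : U) (hu2 : u2 = (3 : ℝ)⁻¹ • ((4 : ℝ) • u1 - u0 + (2 * s) • udot2)) :
    ‖udot2‖ ^ 2 + GM M u2 u1
        ≤ (2 * ((3 + 2 * Real.sqrt 2) / 2) + 1 / (2 * α)) * M u0 u0 ∧
    ‖udot2‖ ^ 2
        ≤ (1 / (2 * α ^ 2) + 2 * ((3 + 2 * Real.sqrt 2) / 2) / α) * M u0 u0 := by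
  have e1 : 2 * (1 + α) * ‖v‖ ^ 2 + M u1 u1 + M (u1 - u0) (u1 - u0) = M u0 u0 := by
    have h := heq1 v hv
    have hd : M u1 (u1 - u0) = s * M u1 v := by
      rw [← smul_eq_mul, ← map_smul]
      congr 1
      rw [hu1]
      abel
    rw [← hu1, real_inner_smul_left, real_inner_self_eq_norm_sq] at h
    have h' : (1 + α) * ‖v‖ ^ 2 + M u1 (u1 - u0) = 0 := by
      rw [hd]
      field_simp at h
      linarith
    have := two_mul_apply_sub_self M hMsymm u1 u0
    linarith
  have e2 : (1 + α) * ‖udot2‖ ^ 2 + GM M u2 u1 ≤ ‖v‖ ^ 2 + GM M u1 u0 := by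
    have h := heq2 udot2 hudot2
    have hd : M u2 ((3 : ℝ) • u2 - (4 : ℝ) • u1 + u0) = 2 * s * M u2 udot2 := by
      rw [← smul_eq_mul, ← map_smul]
      congr 1
      rw [hu2]
      module
    have hM2 : 1 / 3 * M ((4 : ℝ) • u1 - u0 + (2 * s) • udot2) udot2 = M u2 udot2 := by
      rw [hu2, map_smul, LinearMap.smul_apply, smul_eq_mul, one_div]
    rw [hM2, real_inner_smul_left, inner_sub_left, real_inner_self_eq_norm_sq] at h
    have h' : 2 * (‖udot2‖ ^ 2 - ⟪v, udot2⟫) + α * ‖udot2‖ ^ 2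
        + M u2 ((3 : ℝ) • u2 - (4 : ℝ) • u1 + u0) = 0 := by
      rw [hd]
      field_simp at h
      linarith
    rw [apply_bdf2_eq_GM_sub_GM M hMsymm] at h'
    have hsq := hMpos (u2 - (2 : ℝ) • u1 + u0)
    have hin := norm_sub_sq_real v udot2
    have := sq_nonneg ‖v - udot2‖
    linarith
  have hv2 : ‖v‖ ^ 2 ≤ 1 / (2 * α) * M u0 u0 := by
    rw [one_div_mul_eq_div, le_div_iff₀ (by positivity)]
    linarith [hMpos u1, hMpos (u1 - u0), sq_nonneg ‖v‖]
  have h11 : M u1 u1 ≤ M u0 u0 := by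
    have : 0 ≤ 2 * (1 + α) * ‖v‖ ^ 2 := by positivity
    linarith [hMpos (u1 - u0)]
  have hG : GM M u1 u0 ≤ 2 * ((3 + 2 * Real.sqrt 2) / 2) * M u0 u0 := by
    have hl : 0 ≤ (3 + 2 * Real.sqrt 2) / 2 := by positivity
    linarith [GM_le M hMsymm hMpos u1 u0, mul_le_mul_of_nonneg_left h11 hl]
  have hB : 0 ≤ α * ‖udot2‖ ^ 2 := by positivity
  refine ⟨by linarith, ?_⟩
  have hG2 := GM_nonneg M hMsymm hMpos u2 u1
  have hfin : ‖udot2‖ ^ 2 * α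
      ≤ (2 * ((3 + 2 * Real.sqrt 2) / 2) + 1 / (2 * α)) * M u0 u0 := by
    linarith [sq_nonneg ‖udot2‖]
  calc ‖udot2‖ ^ 2
      ≤ (2 * ((3 + 2 * Real.sqrt 2) / 2) + 1 / (2 * α)) * M u0 u0 / α :=
        (le_div_iff₀ hα).2 hfin
    _ = _ := by
        field_simp
        ring
end

section
/- One-step energy identity and energy decay for the BDF-2 accelerated gradient flow: Let U be a real Hilbert space and M : U×U→ℝ a symmetric positive semidefinite bilinear form. Fix s>0, α>0 and an integer n≥3. Let u^{n-1}, u^{n-2} ∈ U and u̇^{n-1} ∈ U be given, let V_n ⊆ U be a linear subspace, and suppose u̇^n ∈ V_n satisfies ⟨(u̇^n − u̇^{n-1})/s, w⟩_U + (α/(ns))⟨u̇^n, w⟩_U + (1/3)·M(4u^{n-1} − u^{n-2} + 2s·u̇^n, w) = 0 for all w ∈ V_n; set u^n := (4u^{n-1} − u^{n-2} + 2s·u̇^n)/3 and d_t²u^n := (u^n − 2u^{n-1} + u^{n-2})/s². Then ( G_M(u^n, u^{n-1}) + ‖u̇^n‖²_U ) + (2α/n)‖u̇^n‖²_U + s²‖(u̇^n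 − u̇^{n-1})/s‖²_U + (s⁴/2)·M(d_t²u^n, d_t²u^n) = G_M(u^{n-1}, u^{n-2}) + ‖u̇^{n-1}‖²_U; in particular G_M(u^n, u^{n-1}) + ‖u̇^n‖²_U ≤ G_M(u^{n-1}, u^{n-2}) + ‖u̇^{n-1}‖²_U. -/
open scoped RealInnerProductSpace

/-- Energy splitting of the BDF-2 difference operator for a symmetric bilinear form. -/
theorem bdf2_bilinear_identity {V : Type*} [AddCommGroup V] [Module ℝ V]
    (M : V →ₗ[ℝ] V →ₗ[ℝ] ℝ) (hM : ∀ u v : V, M u v = M v u) (u v w : V) :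
    M u ((3 : ℝ) • u - (4 : ℝ) • v + w)
      = GM M u v - GM M v w
        + 1 / 2 * M (u - (2 : ℝ) • v + w) (u - (2 : ℝ) • v + w) := by
  simp only [GM, map_add, map_sub, map_smul, LinearMap.add_apply, LinearMap.sub_apply,
    LinearMap.smul_apply, smul_eq_mul]
  rw [hM v u, hM w u, hM w v]
  ring

/-- One-step energy identity and energy decay for the BDF-2 accelerated gradient
flow.  Here `un1, un2, udotn1` play the roles of `u^{n-1}, u^{n-2}, u̇^{n-1}`,
`udotn` the role of the BDF-2 derivative `u̇^n`, and
`un = (4u^{n-1} − u^{n-2} + 2s u̇^n)/3` the new iterate `u^n`. -/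
theorem bdf2_one_step_energy_identity
    {U : Type*} [NormedAddCommGroup U] [InnerProductSpace ℝ U]
    (M : U →ₗ[ℝ] U →ₗ[ℝ] ℝ)
    (hMsymm : ∀ u v : U, M u v = M v u)
    (hMpos : ∀ u : U, 0 ≤ M u u)
    (s α : ℝ) (hs : 0 < s) (hα : 0 < α)
    (n : ℕ) (hn : 3 ≤ n)
    (un1 un2 udotn1 : U)
    (V : Submodule ℝ U) (udotn : U) (hmem : udotn ∈ V)
    (heq : ∀ w ∈ V,
      ⟪s⁻¹ • (udotn - udotn1), w⟫ + (α / ((n : ℝ) * s)) * ⟪udotn, w⟫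
        + 1 / 3 * M ((4 : ℝ) • un1 - un2 + (2 * s) • udotn) w = 0)
    (un : U) (hun : un = (3 : ℝ)⁻¹ • ((4 : ℝ) • un1 - un2 + (2 * s) • udotn)) :
    (GM M un un1 + ‖udotn‖ ^ 2) + (2 * α / (n : ℝ)) * ‖udotn‖ ^ 2
        + s ^ 2 * ‖s⁻¹ • (udotn - udotn1)‖ ^ 2
        + s ^ 4 / 2 * M ((s ^ 2)⁻¹ • (un - (2 : ℝ) • un1 + un2))
            ((s ^ 2)⁻¹ • (un - (2 : ℝ) • un1 + un2))
      = GM M un1 un2 + ‖udotn1‖ ^ 2 ∧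
    GM M un un1 + ‖udotn‖ ^ 2 ≤ GM M un1 un2 + ‖udotn1‖ ^ 2 := by
  have hs0 : s ≠ 0 := hs.ne'
  have hn0 : (n : ℝ) ≠ 0 := by
    have : n ≠ 0 := by omega
    exact_mod_cast this
  have htest := heq udotn hmem
  have hsum : (4 : ℝ) • un1 - un2 + (2 * s) • udotn = (3 : ℝ) • un := by
    rw [hun, smul_inv_smul₀ three_ne_zero]
  have hvel : (3 : ℝ) • un - (4 : ℝ) • un1 + un2 = (2 * s) • udotn := by
    rw [← hsum]; abel
  have hM := bdf2_bilinear_identity M hMsymm un un1 un2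
  rw [hvel, map_smul, smul_eq_mul] at hM
  rw [hsum, map_smul, LinearMap.smul_apply, smul_eq_mul, real_inner_smul_left,
    inner_sub_left, real_inner_self_eq_norm_sq] at htest
  have htest' : 2 * (‖udotn‖ ^ 2 - ⟪udotn1, udotn⟫) + 2 * α / n * ‖udotn‖ ^ 2
      + 2 * s * M un udotn = 0 := by
    field_simp at htest ⊢
    linear_combination 2 * htest
  have hnorm : s ^ 2 * ‖s⁻¹ • (udotn - udotn1)‖ ^ 2
      = ‖udotn‖ ^ 2 - 2 * ⟪udotn1, udotn⟫ + ‖udotn1‖ ^ 2 := by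
    rw [norm_smul, mul_pow, Real.norm_eq_abs, sq_abs, ← mul_assoc, ← mul_pow,
      mul_inv_cancel₀ hs0, one_pow, one_mul, norm_sub_sq_real, real_inner_comm]
  have hdiff : s ^ 4 / 2 * M ((s ^ 2)⁻¹ • (un - (2 : ℝ) • un1 + un2))
        ((s ^ 2)⁻¹ • (un - (2 : ℝ) • un1 + un2))
      = 1 / 2 * M (un - (2 : ℝ) • un1 + un2) (un - (2 : ℝ) • un1 + un2) := by
    rw [map_smul, map_smul, LinearMap.smul_apply, smul_eq_mul, smul_eq_mul]
    field_simp
  refine (and_iff_left_of_imp fun hid => ?_).mpr ?_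
  · have hdamp : 0 ≤ 2 * α / (n : ℝ) * ‖udotn‖ ^ 2 := by positivity
    have hacc : 0 ≤ s ^ 2 * ‖s⁻¹ • (udotn - udotn1)‖ ^ 2 := by positivity
    have hcurv := mul_nonneg (by positivity : 0 ≤ s ^ 4 / 2)
      (hMpos ((s ^ 2)⁻¹ • (un - (2 : ℝ) • un1 + un2)))
    linarith
  · rw [hnorm, hdiff]
    linear_combination htest' - hM
end

section
/- Modified energy stability of the energy-stable BDF-k accelerated gradient method: Let U be a real Hilbert space, M : U×U→ℝ a symmetric positive semidefinite bilinear form, k≥1 an integer, s>0 and α>0. For a sequence (u^n) in U set ũ^n := ∑_{j=0}^{k-1} t̃δ_j u^{n-j} and u̇^n := (ũ^n − ũ^{n-1})/s. Fix an integer n ≥ k+1, let V_n ⊆ U be a linear subspace, and suppose u̇^n ∈ V_n and ⟨(u̇^n − u̇^{n-1})/s, w⟩_U + (α/(ns))⟨u̇^n, w⟩_U + M(ũ^n, w) = 0 for all w∈V_n. Then ( M(ũ^n, ũ^n) + ‖u̇^n‖²_U ) + (2α/n)‖u̇^n‖²_U + s²‖(u̇^n − u̇^{n-1})/s‖²_U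 + s²·M(u̇^n, u̇^n) = M(ũ^{n-1}, ũ^{n-1}) + ‖u̇^{n-1}‖²_U; in particular M(ũ^n, ũ^n) + ‖u̇^n‖²_U ≤ M(ũ^{n-1}, ũ^{n-1}) + ‖u̇^{n-1}‖²_U. -/
open scoped RealInnerProductSpace

/-- Modified energy stability of the energy-stable BDF-`k` accelerated gradient
method: with `ũ^m = ∑_{j=0}^{k-1} t̃δ_j u^{m-j}` and
`u̇^m = (ũ^m − ũ^{m-1})/s`, one step of the modified scheme at time `n ≥ k + 1`
satisfies the one-step energy identity, and in particular the modified total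
energy `M(ũ^n, ũ^n) + ‖u̇^n‖²` decreases. -/
theorem bdfk_modified_energy_stability
    {U : Type*} [NormedAddCommGroup U] [InnerProductSpace ℝ U]
    (M : U →ₗ[ℝ] U →ₗ[ℝ] ℝ)
    (hMsymm : ∀ u v : U, M u v = M v u)
    (hMpos : ∀ u : U, 0 ≤ M u u)
    (k : ℕ) (hk : 1 ≤ k) (s α : ℝ) (hs : 0 < s) (hα : 0 < α)
    (u utilde udot : ℕ → U)
    (hutilde : ∀ m, utilde m = ∑ j ∈ Finset.range k, bdfTildeDelta k j • u (m - j))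
    (hudot : ∀ m, 1 ≤ m → udot m = s⁻¹ • (utilde m - utilde (m - 1)))
    (n : ℕ) (hn : k + 1 ≤ n)
    (V : Submodule ℝ U) (hmem : udot n ∈ V)
    (heq : ∀ w ∈ V,
      ⟪s⁻¹ • (udot n - udot (n - 1)), w⟫ + (α / ((n : ℝ) * s)) * ⟪udot n, w⟫
        + M (utilde n) w = 0) :
    (M (utilde n) (utilde n) + ‖udot n‖ ^ 2) + (2 * α / (n : ℝ)) * ‖udot n‖ ^ 2
        + s ^ 2 * ‖s⁻¹ • (udot n - udot (n - 1))‖ ^ 2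
        + s ^ 2 * M (udot n) (udot n)
      = M (utilde (n - 1)) (utilde (n - 1)) + ‖udot (n - 1)‖ ^ 2 ∧
    M (utilde n) (utilde n) + ‖udot n‖ ^ 2
      ≤ M (utilde (n - 1)) (utilde (n - 1)) + ‖udot (n - 1)‖ ^ 2 := by
  have hn0 : (0 : ℝ) < n := by exact_mod_cast (by omega : 0 < n)
  have hprev : utilde (n - 1) = utilde n - s • udot n := by
    rw [hudot n (by omega), smul_inv_smul₀ hs.ne', sub_sub_cancel]
  have hM : M (utilde (n - 1)) (utilde (n - 1)) =
      M (utilde n) (utilde n) - 2 * s * M (utilde n) (udot n)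
        + s ^ 2 * M (udot n) (udot n) := by
    rw [hprev]
    simp only [map_sub, map_smul, LinearMap.sub_apply, LinearMap.smul_apply, smul_eq_mul,
      hMsymm (udot n) (utilde n)]
    ring
  have hstep : ‖udot n‖ ^ 2 - ⟪udot n, udot (n - 1)⟫ + α / n * ‖udot n‖ ^ 2
      + s * M (utilde n) (udot n) = 0 := by
    have h := heq (udot n) hmem
    rw [real_inner_smul_left, inner_sub_left, real_inner_self_eq_norm_sq,
      real_inner_comm] at h
    field_simp at h ⊢
    linear_combination h
  have hdiff : s ^ 2 * ‖s⁻¹ • (udot n - udot (n - 1))‖ ^ 2 =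
      ‖udot n‖ ^ 2 - 2 * ⟪udot n, udot (n - 1)⟫ + ‖udot (n - 1)‖ ^ 2 := by
    rw [← norm_sub_sq_real, norm_smul, norm_inv, Real.norm_of_nonneg hs.le]
    field_simp
  have hidentity : (M (utilde n) (utilde n) + ‖udot n‖ ^ 2) + (2 * α / (n : ℝ)) * ‖udot n‖ ^ 2
        + s ^ 2 * ‖s⁻¹ • (udot n - udot (n - 1))‖ ^ 2
        + s ^ 2 * M (udot n) (udot n)
      = M (utilde (n - 1)) (utilde (n - 1)) + ‖udot (n - 1)‖ ^ 2 := by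
    rw [hdiff, hM]
    linear_combination 2 * hstep
  refine ⟨hidentity, ?_⟩
  have hdamp : 0 ≤ (2 * α / (n : ℝ)) * ‖udot n‖ ^ 2 := by positivity
  have hjump : 0 ≤ s ^ 2 * ‖s⁻¹ • (udot n - udot (n - 1))‖ ^ 2 := by positivity
  have hnumer : 0 ≤ s ^ 2 * M (udot n) (udot n) := mul_nonneg (sq_nonneg s) (hMpos _)
  linarith
end
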